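/- arXiv:1605.01373 — 2 statements merged into one kernel-verified Lean document; each statement's English description precedes it below -/
import Mathlib

section
/- Let B be a nonzero matrix with nonnegative integer entries such that both B·Bᵀ and Bᵀ·B are irreducible, and suppose n is the smallest positive integer such that f_n(B·Bᵀ) = 0 and f_n(Bᵀ·B) = 0. If n is odd, then n = 2k+1 for some k ≥ 1, B is a square matrix of size k×k, and B can be transformed into the k×k staircase matrix by a permutation of rows together with an independent permutation of columns. -/
open Matrix Polynomial

/-- `f₀ = 0`, `f₁ = 1`, `fᵢ = f_{i−1} − f_{i−2}` for odd `i ≥ 2` and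
`fᵢ = x·f_{i−1} − f_{i−2}` for even `i ≥ 2`. -/
noncomputable def fpoly : ℕ → Polynomial ℤ
  | 0 => 0
  | 1 => 1
  | (n + 2) =>
      if (n + 2) % 2 = 1 then fpoly (n + 1) - fpoly n
      else Polynomial.X * fpoly (n + 1) - fpoly n

/-- A square nonnegative matrix is irreducible if for every pair of indices `(i,j)` some
power of the matrix has strictly positive `(i,j)` entry. -/
def IsIrreducibleMat {n : ℕ} (A : Matrix (Fin n) (Fin n) ℝ) : Prop :=
  ∀ i j : Fin n, ∃ m : ℕ, 1 ≤ m ∧ 0 < (A ^ m) i j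

/-- `X` can be transformed into `Y` by a permutation of rows together with an independent
permutation of columns. -/
def PermEquiv {p q r s : ℕ} (X : Matrix (Fin p) (Fin q) ℝ)
    (Y : Matrix (Fin r) (Fin s) ℝ) : Prop :=
  ∃ (e : Fin p ≃ Fin r) (f : Fin q ≃ Fin s), ∀ i j, X i j = Y (e i) (f j)

/-- The `k × k` staircase matrix: entry `1` exactly when `j = i` or `j = i + 1`. -/
def stairSq (k : ℕ) : Matrix (Fin k) (Fin k) ℝ :=
  Matrix.of fun i j => if (j : ℕ) = (i : ℕ) ∨ (j : ℕ) = (i : ℕ) + 1 then 1 else 0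

/-- The quotients `gpoly k = fpoly (2 * k) / X`. -/
noncomputable def gpoly : ℕ → Polynomial ℤ
  | 0 => 0
  | (k + 1) => fpoly (2 * k + 1) - gpoly k

lemma fpoly_two_mul (k : ℕ) : fpoly (2 * k) = X * gpoly k := by
  induction k with
  | zero => simp [fpoly, gpoly]
  | succ k ih =>
    rw [show 2 * (k + 1) = 2 * k + 2 by ring, fpoly, if_neg (by omega), ih, gpoly]
    ring

lemma fpoly_odd_succ (k : ℕ) :
    fpoly (2 * (k + 1) + 1) = X * gpoly (k + 1) - fpoly (2 * k + 1) := by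
  rw [← fpoly_two_mul, show 2 * (k + 1) + 1 = (2 * k + 1) + 2 by ring, fpoly, if_pos (by omega)]
  rfl

lemma fpoly_gpoly_invariant (k : ℕ) :
    fpoly (2 * k + 1) ^ 2 - X * fpoly (2 * k + 1) * gpoly k + X * gpoly k ^ 2 = 1 := by
  induction k with
  | zero => simp [fpoly, gpoly]
  | succ k ih =>
    rw [fpoly_odd_succ, gpoly]
    linear_combination ih

lemma aeval_fpoly_odd_lower_bound {y : ℝ} (hy : 4 ≤ y) (k : ℕ) :
    0 ≤ aeval y (gpoly k) ∧ 2 * aeval y (gpoly k) + 1 ≤ aeval y (fpoly (2 * k + 1)) := by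
  induction k with
  | zero => simp [fpoly, gpoly]
  | succ k ih =>
    obtain ⟨h0, h1⟩ := ih
    rw [fpoly_odd_succ]
    simp only [map_sub, map_mul, aeval_X]
    have hg : aeval y (gpoly (k + 1)) = aeval y (fpoly (2 * k + 1)) - aeval y (gpoly k) := by
      rw [gpoly, map_sub]
    have hg0 : 0 ≤ aeval y (gpoly (k + 1)) := by rw [hg]; linarith
    refine ⟨hg0, ?_⟩
    nlinarith [mul_le_mul_of_nonneg_right hy hg0]

lemma aeval_mul_self_mulVec_of_mulVec_eq {ι : Type*} [Fintype ι] [DecidableEq ι]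
    {A : Matrix ι ι ℝ} {x : ι → ℝ} {c : ℝ} (h : A *ᵥ x = c • x) (f : Polynomial ℤ) :
    aeval (A * A) f *ᵥ x = aeval (c * c) f • x := by
  have h2 : (A * A) *ᵥ x = (c * c) • x := by
    rw [← Matrix.mulVec_mulVec, h, Matrix.mulVec_smul, h, smul_smul]
  have hpow (m : ℕ) : (A * A) ^ m *ᵥ x = (c * c) ^ m • x := by
    induction m with
    | zero => simp
    | succ m ih => rw [pow_succ, ← Matrix.mulVec_mulVec, h2, Matrix.mulVec_smul, ih, smul_smul,
        pow_succ']
  induction f using Polynomial.induction_on' with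
  | add f g hf hg => simp only [map_add, Matrix.add_mulVec, hf, hg, add_smul]
  | monomial m a =>
    simp only [aeval_monomial, ← Matrix.mulVec_mulVec, hpow, Matrix.mulVec_smul]
    simp [smul_smul, mul_comm, Matrix.intCast_mulVec]

lemma aeval_map_intCast {ι : Type*} [Fintype ι] [DecidableEq ι] (A : Matrix ι ι ℤ)
    (f : Polynomial ℤ) :
    aeval (A.map (Int.cast : ℤ → ℝ)) f = (aeval A f).map (Int.cast : ℤ → ℝ) := by
  exact aeval_algHom_apply ((Int.castRingHom ℝ).mapMatrix.toIntAlgHom) A f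

lemma map_intCast_mul {ι κ μ : Type*} [Fintype κ] (A : Matrix ι κ ℤ) (B : Matrix κ μ ℤ) :
    (A * B).map (Int.cast : ℤ → ℝ) = A.map (Int.cast : ℤ → ℝ) * B.map (Int.cast : ℤ → ℝ) :=
  Matrix.map_mul (f := Int.castRingHom ℝ)

lemma posDef_two_sub {ι : Type*} [Fintype ι] [DecidableEq ι] {A : Matrix ι ι ℝ}
    (hA : A.IsHermitian) {k : ℕ} (hf : aeval (A * A) (fpoly (2 * k + 1)) = 0) :
    ((2 : ℝ) • (1 : Matrix ι ι ℝ) - A).PosDef := by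
  have hH : ((2 : ℝ) • (1 : Matrix ι ι ℝ) - A).IsHermitian :=
    (Matrix.isHermitian_one.smul (by simp [IsSelfAdjoint])).sub hA
  rw [hH.posDef_iff_eigenvalues_pos]
  intro i
  by_contra! hle
  set c := hH.eigenvalues i
  set x : ι → ℝ := ⇑(hH.eigenvectorBasis i) with hx
  have hx0 : x ≠ 0 := by
    intro h
    exact hH.eigenvectorBasis.orthonormal.ne_zero i (by ext j; exact congrFun h j)
  have hev : A *ᵥ x = (2 - c) • x := by
    have := hH.mulVec_eigenvectorBasis i
    rw [← hx, Matrix.sub_mulVec, Matrix.smul_mulVec, Matrix.one_mulVec] at this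
    rw [sub_smul, ← this]
    abel
  have h := aeval_mul_self_mulVec_of_mulVec_eq hev (fpoly (2 * k + 1))
  rw [hf, Matrix.zero_mulVec] at h
  have h4 := aeval_fpoly_odd_lower_bound (y := (2 - c) * (2 - c)) (by nlinarith) k
  rcases smul_eq_zero.1 h.symm with h | h
  · linarith
  · exact hx0 h

/-- If `N` is symmetric and killed by an odd-index `fpoly`, no nonnegative vector is expanded by a
factor of two. -/
lemma exists_mulVec_lt_two_mul {ι : Type*} [Fintype ι] [DecidableEq ι] {N : Matrix ι ι ℤ}
    (hN : Nᵀ = N) {k : ℕ} (hf : aeval (N * N) (fpoly (2 * k + 1)) = 0) {x : ι → ℤ}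
    (hx : ∀ i, 0 ≤ x i) (hx0 : x ≠ 0) : ∃ i, (N *ᵥ x) i < 2 * x i := by
  set A : Matrix ι ι ℝ := N.map Int.cast with hAdef
  have hA : A.IsHermitian := by
    ext i j
    have := congrFun (congrFun hN i) j
    simp only [Matrix.transpose_apply] at this
    simp [hAdef, this]
  have hAf : aeval (A * A) (fpoly (2 * k + 1)) = 0 := by
    rw [hAdef, ← map_intCast_mul N N, aeval_map_intCast, hf]
    ext; simp
  have hpos := (posDef_two_sub hA hAf).dotProduct_mulVec_pos (x := fun i => (x i : ℝ)) (by
    intro h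
    exact hx0 (funext fun i => by simpa using congrFun h i))
  rw [dotProduct] at hpos
  obtain ⟨i, -, hi⟩ := Finset.exists_lt_of_sum_lt (s := Finset.univ) (f := fun _ => (0 : ℝ))
    (by simpa using hpos)
  refine ⟨i, ?_⟩
  have hAx : (A *ᵥ fun i => (x i : ℝ)) i = (((N *ᵥ x) i : ℤ) : ℝ) := by
    simp [Matrix.mulVec, dotProduct, hAdef]
  simp only [Matrix.sub_mulVec, Matrix.smul_mulVec,
    Matrix.one_mulVec, Pi.sub_apply, Pi.smul_apply, smul_eq_mul, hAx] at hi
  have hxi : (0 : ℝ) ≤ x i := by exact_mod_cast hx i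
  have : ((N *ᵥ x) i : ℝ) < 2 * x i := by nlinarith
  exact_mod_cast this

section Tadpole

/-- `v 0, …, v m` is a path of distinct vertices starting at a vertex carrying a loop. -/
structure IsLoopPath {ι : Type*} (N : Matrix ι ι ℤ) (v : ℕ → ι) (m : ℕ) : Prop where
  injOn : Set.InjOn v (Set.Iic m)
  loop : 1 ≤ N (v 0) (v 0)
  step : ∀ t < m, 1 ≤ N (v t) (v (t + 1))

lemma IsLoopPath.mono {ι : Type*} {N : Matrix ι ι ℤ} {v : ℕ → ι} {m j : ℕ}
    (h : IsLoopPath N v m) (hj : j ≤ m) : IsLoopPath N v j :=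
  ⟨h.injOn.mono (Set.Iic_subset_Iic.2 hj), h.loop, fun t ht => h.step t (by omega)⟩

variable {ι : Type*} [Fintype ι] [DecidableEq ι] {N : Matrix ι ι ℤ}

/-- No nonzero nonnegative vector is expanded by a factor of two: the subcriticality condition
satisfied by nonnegative symmetric matrices of spectral radius less than two. -/
def Subcritical (N : Matrix ι ι ℤ) : Prop :=
  ∀ x : ι → ℤ, (∀ i, 0 ≤ x i) → x ≠ 0 → ∃ i, (N *ᵥ x) i < 2 * x i

lemma add_le_sum_range {f : ℕ → ℤ} {n a b : ℕ} (hf : ∀ t, 0 ≤ f t) (hab : a ≠ b) (ha : a < n)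
    (hb : b < n) : f a + f b ≤ ∑ t ∈ Finset.range n, f t := by
  rw [← Finset.sum_pair hab]
  refine Finset.sum_le_sum_of_subset_of_nonneg ?_ fun t _ _ => hf t
  intro t ht
  simp only [Finset.mem_insert, Finset.mem_singleton] at ht
  simp only [Finset.mem_range]
  omega

lemma Subcritical.not_weighted_path (hsub : Subcritical N) (hN : ∀ i j, 0 ≤ N i j) {v : ℕ → ι}
    {m : ℕ} (hv : Set.InjOn v (Set.Iic m)) {y : ℕ → ℤ} (hy : ∀ t, 0 ≤ y t) (hy0 : 0 < y 0)
    {u : ι} {c : ℤ} (hc : 0 ≤ c) (hu : c = 0 ∨ ∀ t ≤ m, v t ≠ u)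
    (hpath : ∀ s ≤ m, 2 * y s ≤
      ∑ t ∈ Finset.range (m + 1), N (v s) (v t) * y t + N (v s) u * c)
    (hleaf : 0 < c → 2 * c ≤ ∑ t ∈ Finset.range (m + 1), N u (v t) * y t) : False := by
  set x : ι → ℤ := fun i =>
    ∑ t ∈ Finset.range (m + 1), (if v t = i then y t else 0) + if u = i then c else 0 with hx
  have hterm (i : ι) (t : ℕ) : 0 ≤ if v t = i then y t else 0 := by split_ifs <;> simp [hy]
  have hx_nonneg (i : ι) : 0 ≤ x i :=
    add_nonneg (Finset.sum_nonneg fun t _ => hterm i t) (by split_ifs <;> simp [hc])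
  have hx_path (s : ℕ) (hs : s ≤ m) : x (v s) = y s := by
    have h1 : ∑ t ∈ Finset.range (m + 1), (if v t = v s then y t else 0) = y s := by
      rw [Finset.sum_eq_single s]
      · simp
      · intro t ht hts
        rw [if_neg]
        intro h
        exact hts (hv (by simp at ht ⊢; omega) (by simpa using hs) h)
      · intro h
        simp at h
        omega
    have h2 : (if u = v s then c else 0) = 0 := by
      rcases hu with rfl | hu
      · simp
      · rw [if_neg (hu s hs).symm]
    simp only [hx, h1, h2, add_zero]
  have hmul (a : ι) :
      (N *ᵥ x) a = ∑ t ∈ Finset.range (m + 1), N a (v t) * y t + N a u * c := by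
    simp only [Matrix.mulVec, dotProduct, hx, mul_add, Finset.sum_add_distrib, Finset.mul_sum]
    rw [Finset.sum_comm]
    simp
  have hx0 : x ≠ 0 := by
    intro h
    have := hx_path 0 (by omega)
    rw [h] at this
    simp at this
    omega
  obtain ⟨i, hi⟩ := hsub x hx_nonneg hx0
  by_cases hmem : ∃ s ≤ m, v s = i
  · obtain ⟨s, hs, rfl⟩ := hmem
    rw [hmul, hx_path s hs] at hi
    linarith [hpath s hs]
  · push Not at hmem
    have hxi : x i = if u = i then c else 0 := by
      simp only [hx]
      rw [Finset.sum_eq_zero, zero_add]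
      intro t ht
      rw [if_neg (hmem t (by simp at ht; omega))]
    have hge : 0 ≤ (N *ᵥ x) i :=
      Finset.sum_nonneg fun j _ => mul_nonneg (hN i j) (hx_nonneg j)
    rw [hxi] at hi
    split_ifs at hi with hui
    · subst hui
      have hc0 : 0 < c := by linarith
      rw [hmul] at hi
      linarith [hleaf hc0, mul_nonneg (hN u u) hc]
    · linarith

lemma IsLoopPath.sum_le_one (hsub : Subcritical N) (hN : ∀ i j, 0 ≤ N i j) (hsymm : Nᵀ = N)
    {v : ℕ → ι} {j : ℕ} (h : IsLoopPath N v j) :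
    ∑ t ∈ Finset.range (j + 1), N (v j) (v t) ≤ 1 := by
  by_contra! hlt
  refine hsub.not_weighted_path hN h.injOn (y := fun _ => 1) (u := v 0) (c := 0) (by simp)
    (by simp) le_rfl (Or.inl rfl) ?_ (by simp)
  intro s hs
  simp only [mul_one, mul_zero, add_zero]
  rcases hs.eq_or_lt with rfl | hs
  · linarith
  have hnext := h.step s hs
  rcases Nat.eq_zero_or_pos s with rfl | hs0
  · have := add_le_sum_range (f := fun t => N (v 0) (v t)) (n := j + 1) (fun t => hN _ _)
      (zero_ne_one) (by omega) (by omega)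
    simp only [zero_add] at hnext
    linarith [h.loop]
  · have hprev := h.step (s - 1) (by omega)
    rw [Nat.sub_add_cancel hs0, ← hsymm, Matrix.transpose_apply] at hprev
    have := add_le_sum_range (f := fun t => N (v s) (v t)) (n := j + 1) (a := s - 1) (b := s + 1)
      (fun t => hN _ _) (by omega) (by omega) (by omega)
    linarith

lemma IsLoopPath.eq_zero_of_notMem (hsub : Subcritical N) (hN : ∀ i j, 0 ≤ N i j)
    (hsymm : Nᵀ = N) {v : ℕ → ι} {m i : ℕ} (h : IsLoopPath N v m) (hi : i < m) {u : ι}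
    (hu : ∀ t ≤ m, v t ≠ u) : N (v i) u = 0 := by
  by_contra hne
  have hpos : 1 ≤ N (v i) u := by have := hN (v i) u; omega
  have hsy (a b : ι) : N a b = N b a := congrFun (congrFun hsymm b) a
  set y : ℕ → ℤ := fun t => if t ≤ i then 2 else 1 with hy
  have hy_nonneg (t : ℕ) : 0 ≤ y t := by simp only [hy]; split_ifs <;> norm_num
  have hy_lo (t : ℕ) (ht : t ≤ i) : y t = 2 := if_pos ht
  have hy_hi : y (i + 1) = 1 := if_neg (by omega)
  refine hsub.not_weighted_path hN (m := i + 1) (h.mono (by omega)).injOn (y := y) (u := u)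
    (c := 1) hy_nonneg (by simp [hy]) zero_le_one
    (Or.inr fun t ht => hu t (by omega)) ?_ ?_
  · intro s hs
    have hnn (t : ℕ) : 0 ≤ N (v s) (v t) * y t := mul_nonneg (hN _ _) (hy_nonneg t)
    rcases hs.eq_or_lt with rfl | hs
    · have := Finset.single_le_sum (f := fun t => N (v (i + 1)) (v t) * y t)
        (s := Finset.range (i + 1 + 1)) (fun t _ => hnn t) (a := i) (by simp)
      simp only [hy_lo i le_rfl] at this
      have := h.step i hi
      rw [hsy] at this
      have := hN (v (i + 1)) u
      linarith
    · have hnext := h.step s (by omega)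
      have hback : ∃ a < i + 2, a ≠ s + 1 ∧ a ≤ i ∧ 1 ≤ N (v s) (v a) := by
        rcases Nat.eq_zero_or_pos s with rfl | hs0
        · exact ⟨0, by omega, by omega, by omega, h.loop⟩
        · refine ⟨s - 1, by omega, by omega, by omega, ?_⟩
          have hprev := h.step (s - 1) (by omega)
          rwa [Nat.sub_add_cancel hs0, hsy] at hprev
      obtain ⟨a, ha, has, hai, hNa⟩ := hback
      have hsum := add_le_sum_range (f := fun t => N (v s) (v t) * y t) (n := i + 1 + 1)
        hnn has ha (by omega)
      simp only [hy_lo a hai] at hsum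
      rw [hy_lo s (by omega)]
      rcases (Nat.lt_succ_iff.1 hs).eq_or_lt with rfl | hs
      · rw [hy_hi] at hsum
        linarith
      · rw [hy_lo (s + 1) hs] at hsum
        have := hN (v s) u
        linarith
  · intro _
    have := Finset.single_le_sum (f := fun t => N u (v t) * y t)
      (s := Finset.range (i + 1 + 1)) (fun t _ => mul_nonneg (hN _ _) (hy_nonneg t))
      (a := i) (by simp)
    simp only [hy_lo i le_rfl] at this
    rw [hsy] at hpos
    linarith

/-- The path on `0, 1, 2, …` with a loop at `0`. -/
def tadpole (a b : ℕ) : ℤ :=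
  if (a = 0 ∧ b = 0) ∨ a + 1 = b ∨ b + 1 = a then 1 else 0

lemma IsLoopPath.apply_eq_tadpole (hsub : Subcritical N) (hN : ∀ i j, 0 ≤ N i j)
    (hsymm : Nᵀ = N) {v : ℕ → ι} {m a b : ℕ} (h : IsLoopPath N v m) (ha : a ≤ m) (hb : b ≤ m) :
    N (v a) (v b) = tadpole a b := by
  wlog hab : b ≤ a generalizing a b
  · rw [← hsymm, Matrix.transpose_apply, this hb ha (by omega)]
    exact if_congr (by omega) rfl rfl
  have hsum := (h.mono ha).sum_le_one hsub hN hsymm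
  have hnn (t : ℕ) : 0 ≤ N (v a) (v t) := hN _ _
  unfold tadpole
  have hb_le := Finset.single_le_sum (f := fun t => N (v a) (v t))
    (s := Finset.range (a + 1)) (fun t _ => hnn t) (a := b) (by simp; omega)
  rcases Nat.eq_zero_or_pos a with rfl | ha0
  · obtain rfl : b = 0 := by omega
    rw [if_pos (by omega)]
    linarith [h.loop]
  have hprev := h.step (a - 1) (by omega)
  rw [Nat.sub_add_cancel ha0, ← hsymm, Matrix.transpose_apply] at hprev
  by_cases hba : b + 1 = a
  · rw [if_pos (by omega)]
    subst hba
    simp only [Nat.add_sub_cancel] at hprev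
    linarith
  · rw [if_neg (by omega)]
    have := add_le_sum_range (f := fun t => N (v a) (v t)) (n := a + 1) (a := a - 1) (b := b)
      hnn (by omega) (by omega) (by omega)
    linarith [hnn b]

lemma pow_apply_eq_zero_of_closed {S : Set ι} {A : Matrix ι ι ℤ}
    (hA : ∀ i ∈ S, ∀ j ∉ S, A i j = 0) (m : ℕ) : ∀ i ∈ S, ∀ j ∉ S, (A ^ m) i j = 0 := by
  induction m with
  | zero =>
    intro i hi j hj
    rw [pow_zero, Matrix.one_apply_ne]
    rintro rfl
    exact hj hi
  | succ m ih =>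
    intro i hi j hj
    rw [pow_succ, Matrix.mul_apply]
    refine Finset.sum_eq_zero fun l _ => ?_
    by_cases hl : l ∈ S
    · rw [hA l hl j hj, mul_zero]
    · rw [ih i hi l hl, zero_mul]

/-- A connected subcritical nonnegative symmetric integer matrix with a loop is a path with a
loop at one end. -/
lemma exists_equiv_tadpole (hsub : Subcritical N) (hN : ∀ i j, 0 ≤ N i j) (hsymm : Nᵀ = N)
    (hirr : ∀ i j, ∃ m : ℕ, 0 < (N ^ m) i j) {a : ι} (ha : N a a ≠ 0) :
    ∃ (k : ℕ) (v : Fin k ≃ ι), ∀ i j, N (v i) (v j) = tadpole i j := by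
  classical
  have hcard {v : ℕ → ι} {m : ℕ} (h : IsLoopPath N v m) : m < Fintype.card ι := by
    have h1 : ((Finset.Iic m).image v).card = m + 1 := by
      rw [Finset.card_image_of_injOn (by simpa using h.injOn), Nat.card_Iic]
    have := Finset.card_le_univ ((Finset.Iic m).image v)
    omega
  have h0 : ∃ v, IsLoopPath N v 0 := by
    refine ⟨fun _ => a, fun x hx y hy _ => by simp at hx hy; omega, ?_, by simp⟩
    have := hN a a
    omega
  set m := Nat.findGreatest (fun m => ∃ v, IsLoopPath N v m) (Fintype.card ι) with hm
  obtain ⟨v, hv⟩ : ∃ v, IsLoopPath N v m :=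
    Nat.findGreatest_spec (P := fun m => ∃ v, IsLoopPath N v m) (Nat.zero_le _) h0
  have hmax (w : ℕ → ι) : ¬ IsLoopPath N w (m + 1) := fun hw =>
    Nat.findGreatest_is_greatest (P := fun m => ∃ v, IsLoopPath N v m) (Nat.lt_succ_self m)
      (hcard hw).le ⟨w, hw⟩
  have hclosed : ∀ i ∈ v '' Set.Iic m, ∀ j ∉ v '' Set.Iic m, N i j = 0 := by
    rintro _ ⟨t, ht, rfl⟩ u hu
    have hu' : ∀ t ≤ m, v t ≠ u := fun t ht h => hu ⟨t, ht, h⟩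
    rcases (Set.mem_Iic.1 ht).eq_or_lt with rfl | hlt
    · by_contra hne
      refine hmax (Function.update v (m + 1) u) ⟨?_, ?_, ?_⟩
      · intro x hx y hy hxy
        simp only [Set.mem_Iic] at hx hy
        rcases hx.eq_or_lt with rfl | hx <;> rcases hy.eq_or_lt with rfl | hy
        · rfl
        · rw [Function.update_self, Function.update_of_ne hy.ne] at hxy
          exact absurd hxy.symm (hu' y (by omega))
        · rw [Function.update_self, Function.update_of_ne hx.ne] at hxy
          exact absurd hxy (hu' x (by omega))
        · rw [Function.update_of_ne hx.ne, Function.update_of_ne hy.ne] at hxy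
          exact hv.injOn (by simp; omega) (by simp; omega) hxy
      · rw [Function.update_of_ne (by omega)]
        exact hv.loop
      · intro s hs
        rw [Function.update_of_ne (by omega)]
        rcases (Nat.lt_succ_iff.1 hs).eq_or_lt with rfl | hs
        · rw [Function.update_self]
          have := hN (v m) u
          omega
        · rw [Function.update_of_ne (by omega)]
          exact hv.step s hs
    · exact hv.eq_zero_of_notMem hsub hN hsymm hlt hu'
  have hsurj (u : ι) : u ∈ v '' Set.Iic m := by
    by_contra hu
    obtain ⟨r, hr⟩ := hirr (v 0) u
    exact hr.ne' (pow_apply_eq_zero_of_closed hclosed r _ ⟨0, by simp, rfl⟩ _ hu)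
  refine ⟨m + 1, Equiv.ofBijective (fun i : Fin (m + 1) => v i) ⟨?_, ?_⟩, ?_⟩
  · intro i j hij
    exact Fin.ext (hv.injOn (by simp; omega) (by simp; omega) hij)
  · intro u
    obtain ⟨t, ht, rfl⟩ := hsurj u
    exact ⟨⟨t, Nat.lt_succ_of_le ht⟩, rfl⟩
  · intro i j
    exact hv.apply_eq_tadpole hsub hN hsymm (by omega) (by omega)

end Tadpole

lemma even_sum_of_symm {ι : Type*} [Fintype ι] {F : ι → ι → ℤ}
    (hsymm : ∀ i j, F i j = F j i) (hdiag : ∀ i, Even (F i i)) : Even (∑ i, ∑ j, F i j) := by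
  rw [even_iff_two_dvd]
  refine (ZMod.intCast_zmod_eq_zero_iff_dvd _ 2).1 ?_
  push_cast
  rw [← Finset.sum_product' Finset.univ Finset.univ (fun i j => ((F i j : ℤ) : ZMod 2))]
  refine Finset.sum_involution (fun x _ => x.swap) ?_ ?_ (by simp) (by simp)
  · rintro ⟨i, j⟩ -
    simp only [Prod.swap_prod_mk]
    rw [hsymm j i]
    exact CharTwo.add_self_eq_zero _
  · rintro ⟨i, j⟩ - hne heq
    obtain rfl : j = i := congrArg Prod.fst heq
    exact hne ((ZMod.intCast_zmod_eq_zero_iff_dvd _ 2).2 (even_iff_two_dvd.1 (hdiag j)))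

section PolynomialIdentities

variable {ι κ : Type*} [Fintype ι] [DecidableEq ι] [Fintype κ] [DecidableEq κ]

lemma commute_aeval_mul_self (A : Matrix ι ι ℤ) (f : Polynomial ℤ) :
    A * aeval (A * A) f = aeval (A * A) f * A := by
  have h : aeval (A * A) f = aeval A (f.comp (X * X)) := by simp [aeval_comp]
  have hX : aeval A (X : Polynomial ℤ) = A := aeval_X A
  rw [h]
  nth_rewrite 1 [← hX]
  nth_rewrite 4 [← hX]
  rw [← map_mul, ← map_mul, mul_comm]

lemma aeval_mul_intertwine (B : Matrix ι κ ℤ) (C : Matrix κ ι ℤ) (f : Polynomial ℤ) :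
    aeval (B * C) f * B = B * aeval (C * B) f := by
  have hpow (m : ℕ) : (B * C) ^ m * B = B * (C * B) ^ m := by
    induction m with
    | zero => simp
    | succ m ih => rw [pow_succ', pow_succ', Matrix.mul_assoc, ih]; simp only [Matrix.mul_assoc]
  induction f using Polynomial.induction_on' with
  | add f g hf hg => simp only [map_add, Matrix.add_mul, Matrix.mul_add, hf, hg]
  | monomial m a =>
    simp only [aeval_monomial, hpow, eq_intCast, ← zsmul_eq_mul, Matrix.smul_mul,
      Matrix.mul_smul]

lemma transpose_aeval (A : Matrix ι ι ℤ) (f : Polynomial ℤ) :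
    (aeval A f)ᵀ = aeval Aᵀ f := by
  induction f using Polynomial.induction_on' with
  | add f g hf hg => simp only [map_add, Matrix.transpose_add, hf, hg]
  | monomial m a =>
    simp only [aeval_monomial, eq_intCast, ← zsmul_eq_mul, Matrix.transpose_smul,
      Matrix.transpose_pow]

lemma aeval_gpoly_sq {A : Matrix ι ι ℤ} {k : ℕ} (h : aeval A (fpoly (2 * k + 1)) = 0) :
    A * (aeval A (gpoly k) * aeval A (gpoly k)) = 1 := by
  have := congrArg (aeval A) (fpoly_gpoly_invariant k)
  simpa [h, sq] using this

lemma even_diag_aeval_mul_self_mul {N : Matrix ι ι ℤ} (hsymm : Nᵀ = N)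
    (hdiag : ∀ i, Even (N i i)) (f : Polynomial ℤ) (i : ι) :
    Even ((aeval (N * N) f * N) i i) := by
  induction f using Polynomial.induction_on' with
  | add f g hf hg =>
    rw [map_add, Matrix.add_mul, Matrix.add_apply]
    exact hf.add hg
  | monomial m a =>
    have h1 : (N * N) ^ m * N = (N ^ m)ᵀ * N * N ^ m := by
      rw [Matrix.transpose_pow, hsymm, ← pow_succ, ← pow_add, ← sq, ← pow_mul, ← pow_succ]
      congr 1
      ring
    rw [aeval_monomial, Matrix.mul_assoc, h1, eq_intCast, ← zsmul_eq_mul, Matrix.smul_apply,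
      smul_eq_mul]
    refine Even.mul_left ?_ a
    have h2 : ((N ^ m)ᵀ * N * N ^ m) i i =
        ∑ j, ∑ l, (N ^ m) l i * N l j * (N ^ m) j i := by
      simp only [Matrix.mul_apply, Finset.sum_mul, Matrix.transpose_apply]
    rw [h2]
    refine even_sum_of_symm (fun j l => ?_) fun j => ?_
    · rw [show N l j = N j l from congrFun (congrFun hsymm j) l]
      ring
    · exact ((hdiag j).mul_left _).mul_right _

lemma exists_unique_ne_zero_of_sum_sq_eq_one {f : κ → ℤ} (h : ∑ j, f j * f j = 1) :
    ∃ j, f j * f j = 1 ∧ ∀ l, f l ≠ 0 → l = j := by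
  obtain ⟨j, hj⟩ : ∃ j, f j ≠ 0 := by
    by_contra! h0
    simp [h0] at h
  have hsplit := Finset.add_sum_erase Finset.univ (fun j => f j * f j) (Finset.mem_univ j)
  have hrest : 0 ≤ ∑ l ∈ Finset.univ.erase j, f l * f l :=
    Finset.sum_nonneg fun l _ => mul_self_nonneg _
  have hj1 : 0 < f j * f j := mul_self_pos.2 hj
  simp only [h] at hsplit
  refine ⟨j, by linarith, fun l hl => ?_⟩
  by_contra hlj
  have h1 := Finset.single_le_sum (f := fun l => f l * f l) (s := Finset.univ.erase j)
    (fun l _ => mul_self_nonneg _) (a := l) (by simp [hlj])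
  have hl1 : 0 < f l * f l := mul_self_pos.2 hl
  linarith

/-- An integer orthogonal matrix is a signed permutation matrix. -/
lemma exists_equiv_of_orthogonal {G : Matrix ι κ ℤ} (h1 : G * Gᵀ = 1) (h2 : Gᵀ * G = 1) :
    ∃ σ : ι ≃ κ, (∀ i, G i (σ i) * G i (σ i) = 1) ∧ ∀ i j, G i j ≠ 0 → j = σ i := by
  have hrow (i : ι) := exists_unique_ne_zero_of_sum_sq_eq_one (f := fun j => G i j)
    (by simpa [Matrix.mul_apply] using congrFun (congrFun h1 i) i)
  have hcol (j : κ) := exists_unique_ne_zero_of_sum_sq_eq_one (f := fun i => G i j)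
    (by simpa [Matrix.mul_apply] using congrFun (congrFun h2 j) j)
  choose σ hσ hσ' using hrow
  choose τ hτ hτ' using hcol
  have hne {a : ℤ} (h : a * a = 1) : a ≠ 0 := by rintro rfl; simp at h
  exact ⟨⟨σ, τ, fun i => (hτ' _ i (hne (hσ i))).symm, fun j => (hσ' _ j (hne (hτ j))).symm⟩,
    hσ, hσ'⟩

/-- If an odd-index `fpoly` kills both Gram matrices of `B`, then the rows and columns of `B` can
be matched so that `B` becomes symmetric. -/
lemma exists_equiv_symm_submatrix {B : Matrix ι κ ℤ} (hB : ∀ i j, 0 ≤ B i j) {k : ℕ}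
    (h1 : aeval (B * Bᵀ) (fpoly (2 * k + 1)) = 0)
    (h2 : aeval (Bᵀ * B) (fpoly (2 * k + 1)) = 0) :
    ∃ σ : ι ≃ κ, (B.submatrix id σ)ᵀ = B.submatrix id σ ∧
      ∀ i, ¬ Even ((aeval (B * Bᵀ) (gpoly k) * B.submatrix id σ) i i) := by
  set g := aeval (B * Bᵀ) (gpoly k) with hg
  have hgB : g * B = B * aeval (Bᵀ * B) (gpoly k) := aeval_mul_intertwine B Bᵀ _
  have hgT : gᵀ = g := by rw [hg, transpose_aeval]; simp
  have hcomm : g * (B * Bᵀ) = (B * Bᵀ) * g := by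
    rw [← Matrix.mul_assoc, hgB, Matrix.mul_assoc, aeval_mul_intertwine Bᵀ B,
      Matrix.mul_assoc]
  have hG1 : (g * B) * (g * B)ᵀ = 1 := by
    rw [Matrix.transpose_mul, hgT, ← aeval_gpoly_sq h1, ← hg, ← Matrix.mul_assoc (B * Bᵀ),
      ← hcomm]
    simp only [Matrix.mul_assoc]
  have hG2 : (g * B)ᵀ * (g * B) = 1 := by
    rw [Matrix.transpose_mul, hgT, Matrix.mul_assoc, hgB, ← aeval_gpoly_sq h2,
      ← Matrix.mul_assoc g, hgB]
    simp only [Matrix.mul_assoc]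
  obtain ⟨σ, hσ, hσ'⟩ := exists_equiv_of_orthogonal hG1 hG2
  have hentry (i j : ι) : (g * (B * Bᵀ)) i j = (g * B) i (σ i) * B j (σ i) := by
    rw [← Matrix.mul_assoc, Matrix.mul_apply, Finset.sum_eq_single (σ i)]
    · rfl
    · intro l _ hl
      have : (g * B) i l = 0 := by
        by_contra h
        exact hl (hσ' i l h)
      rw [this, zero_mul]
    · simp
  have hsymm : (g * (B * Bᵀ))ᵀ = g * (B * Bᵀ) := by
    rw [Matrix.transpose_mul, hgT, hcomm]
    simp
  refine ⟨σ, ?_, fun i => ?_⟩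
  · ext i j
    have h := congrFun (congrFun hsymm i) j
    rw [Matrix.transpose_apply, hentry, hentry] at h
    have hsq : B i (σ j) * B i (σ j) = B j (σ i) * B j (σ i) := by
      calc _ = ((g * B) j (σ j) * (g * B) j (σ j)) * (B i (σ j) * B i (σ j)) := by
            rw [hσ, one_mul]
        _ = ((g * B) j (σ j) * B i (σ j)) * ((g * B) j (σ j) * B i (σ j)) := by ring
        _ = ((g * B) i (σ i) * (g * B) i (σ i)) * (B j (σ i) * B j (σ i)) := by rw [h]; ring
        _ = _ := by rw [hσ, one_mul]
    exact ((mul_self_inj (hB _ _) (hB _ _)).1 hsq).symm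
  · have h : (g * B.submatrix id σ) i i = (g * B) i (σ i) := by
      simp [Matrix.mul_apply]
    rw [h]
    intro heven
    have := heven.mul_left ((g * B) i (σ i))
    rw [hσ] at this
    exact absurd this (by decide)

end PolynomialIdentities

section TadpolePolynomials

/-- The `k × k` tadpole matrix. -/
def tadpoleMatrix (k : ℕ) : Matrix (Fin k) (Fin k) ℤ := Matrix.of fun i j => tadpole i j

/-- The indicator of the position at time `t` of a walk that starts at vertex `k - 1`, runs down
to the loop at `0`, uses the loop once and returns. -/
def tadpoleWalk (k t : ℕ) : Fin k → ℤ := fun i =>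
  if (i : ℕ) + t + 1 = k ∨ t = (i : ℕ) + k then 1 else 0

lemma tadpoleMatrix_mulVec_walk {k t : ℕ} (j : Fin k) (hj : (j : ℕ) + t + 1 = k ∨ t = j + k)
    (i : Fin k) : (tadpoleMatrix k *ᵥ tadpoleWalk k t) i = tadpole i j := by
  rw [Matrix.mulVec, dotProduct, Finset.sum_eq_single j]
  · rw [tadpoleWalk, if_pos hj, mul_one]
    rfl
  · intro l _ hl
    rw [tadpoleWalk, if_neg, mul_zero]
    have := Fin.val_ne_of_ne hl
    omega
  · simp

lemma exists_walk_position {k t : ℕ} (ht : t < 2 * k) :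
    ∃ j : Fin k, (j : ℕ) + t + 1 = k ∨ t = j + k := by
  by_cases h : t < k
  · exact ⟨⟨k - 1 - t, by omega⟩, Or.inl (by simp; omega)⟩
  · exact ⟨⟨t - k, by omega⟩, Or.inr (by simp; omega)⟩

lemma tadpoleMatrix_mulVec_walk_zero (k : ℕ) (hk : 1 ≤ k) :
    tadpoleMatrix k *ᵥ tadpoleWalk k 0 = tadpoleWalk k 1 := by
  ext i
  obtain ⟨j, hj⟩ := exists_walk_position (k := k) (t := 0) (by omega)
  rw [tadpoleMatrix_mulVec_walk (t := 0) j hj, tadpole, tadpoleWalk]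
  exact if_congr (by omega) rfl rfl

lemma tadpoleMatrix_mulVec_walk_succ {k t : ℕ} (ht : t + 1 < 2 * k) :
    tadpoleMatrix k *ᵥ tadpoleWalk k (t + 1) = tadpoleWalk k (t + 2) + tadpoleWalk k t := by
  ext i
  obtain ⟨j, hj⟩ := exists_walk_position ht
  rw [tadpoleMatrix_mulVec_walk j hj, Pi.add_apply, tadpole, tadpoleWalk, tadpoleWalk]
  split_ifs <;> first | rfl | omega

lemma aeval_tadpoleMatrix_mulVec {k : ℕ} (hk : 1 ≤ k) (s : ℕ) (hs : s ≤ k) :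
    aeval (tadpoleMatrix k * tadpoleMatrix k) (fpoly (2 * s + 1)) *ᵥ tadpoleWalk k 0 =
      tadpoleWalk k (2 * s) ∧
    (s < k → aeval (tadpoleMatrix k * tadpoleMatrix k) (gpoly (s + 1)) *ᵥ
      (tadpoleMatrix k *ᵥ tadpoleWalk k 0) = tadpoleWalk k (2 * s + 1)) := by
  induction s with
  | zero =>
    simp [fpoly, gpoly, tadpoleMatrix_mulVec_walk_zero k hk]
  | succ s ih =>
    obtain ⟨ih1, ih2⟩ := ih (by omega)
    replace ih2 := ih2 (by omega)
    have h1 : aeval (tadpoleMatrix k * tadpoleMatrix k) (fpoly (2 * (s + 1) + 1)) *ᵥ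
        tadpoleWalk k 0 = tadpoleWalk k (2 * (s + 1)) := by
      rw [fpoly_odd_succ, map_sub, map_mul, aeval_X, Matrix.sub_mulVec, ih1, Matrix.mul_assoc,
        commute_aeval_mul_self, ← Matrix.mulVec_mulVec, ← Matrix.mulVec_mulVec, ih2,
        tadpoleMatrix_mulVec_walk_succ (by omega), add_sub_cancel_right]
      rfl
    refine ⟨h1, fun hlt => ?_⟩
    rw [gpoly, map_sub, Matrix.sub_mulVec, ih2, Matrix.mulVec_mulVec, ← commute_aeval_mul_self,
      ← Matrix.mulVec_mulVec, h1, show 2 * (s + 1) = 2 * s + 1 + 1 by ring,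
      tadpoleMatrix_mulVec_walk_succ (by omega), add_sub_cancel_right]

lemma aeval_tadpoleMatrix_ne_zero {k s : ℕ} (hs : s < k) :
    aeval (tadpoleMatrix k * tadpoleMatrix k) (fpoly (2 * s + 1)) ≠ 0 := by
  intro h
  have h1 := (aeval_tadpoleMatrix_mulVec (by omega) s hs.le).1
  rw [h, Matrix.zero_mulVec] at h1
  obtain ⟨j, hj⟩ := exists_walk_position (k := k) (t := 2 * s) (by omega)
  have := congrFun h1 j
  rw [tadpoleWalk, if_pos hj] at this
  exact absurd this (by simp)

lemma aeval_tadpoleMatrix_eq_zero (k : ℕ) :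
    aeval (tadpoleMatrix k * tadpoleMatrix k) (fpoly (2 * k + 1)) = 0 := by
  ext i j
  have hk : 1 ≤ k := by have := j.2; omega
  obtain ⟨s, hs, hsj⟩ : ∃ s, s < k ∧ ((j : ℕ) + 2 * s + 1 = k ∨ 2 * s = j + k) := by
    rcases Nat.even_or_odd' ((j : ℕ) + k) with ⟨s, hs | hs⟩
    · exact ⟨s, by omega, Or.inr hs.symm⟩
    · exact ⟨(k - 1 - j) / 2, by omega, by omega⟩
  have hwalk : tadpoleWalk k (2 * s) = Pi.single j 1 := by
    ext l
    rw [tadpoleWalk, Pi.single_apply]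
    exact if_congr (by rw [Fin.ext_iff]; omega) rfl rfl
  have hzero : tadpoleWalk k (2 * k) = 0 := by
    ext l
    rw [tadpoleWalk, if_neg (by omega)]
    rfl
  have h : aeval (tadpoleMatrix k * tadpoleMatrix k) (fpoly (2 * k + 1)) *ᵥ Pi.single j 1 = 0 := by
    rw [← hwalk, ← (aeval_tadpoleMatrix_mulVec hk s hs.le).1, Matrix.mulVec_mulVec, ← map_mul,
      mul_comm, map_mul, ← Matrix.mulVec_mulVec, (aeval_tadpoleMatrix_mulVec hk k le_rfl).1,
      hzero, Matrix.mulVec_zero]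
  simpa using congrFun h i

end TadpolePolynomials

/-- The tadpole matrix becomes the staircase matrix after permuting rows and columns. -/
lemma exists_equiv_stairSq (k : ℕ) :
    ∃ e f : Fin k ≃ Fin k, ∀ i j : Fin k, (tadpole i j : ℝ) = stairSq k (e i) (f j) := by
  let e : Fin k → Fin k := fun a =>
    ⟨if (k + a) % 2 = 0 then (k - 2 - a) / 2 else (k + a - 1) / 2, by split_ifs <;> omega⟩
  let f : Fin k → Fin k := fun b =>
    ⟨if (k + b) % 2 = 1 then (k - 1 - b) / 2 else (k + b) / 2, by split_ifs <;> omega⟩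
  have he : Function.Injective e := by
    intro a b hab
    simp only [e, Fin.mk.injEq] at hab
    split_ifs at hab <;> omega
  have hf : Function.Injective f := by
    intro a b hab
    simp only [f, Fin.mk.injEq] at hab
    split_ifs at hab <;> omega
  refine ⟨Equiv.ofBijective e (Finite.injective_iff_bijective.1 he),
    Equiv.ofBijective f (Finite.injective_iff_bijective.1 hf), fun i j => ?_⟩
  simp only [tadpole, stairSq, Matrix.of_apply, Equiv.ofBijective_apply, Int.cast_ite,
    Int.cast_one, Int.cast_zero]
  refine if_congr ?_ rfl rfl
  simp only [e, f]
  split_ifs <;> omega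

lemma aeval_reindex_eq_zero_iff {ι κ : Type*} [Fintype ι] [DecidableEq ι] [Fintype κ]
    [DecidableEq κ] (e : ι ≃ κ) (A : Matrix ι ι ℤ) (f : Polynomial ℤ) :
    aeval (Matrix.reindex e e A) f = 0 ↔ aeval A f = 0 := by
  have h : aeval (Matrix.reindex e e A) f = Matrix.reindexAlgEquiv ℤ ℤ e (aeval A f) :=
    aeval_algHom_apply (Matrix.reindexAlgEquiv ℤ ℤ e) A f
  rw [h, EmbeddingLike.map_eq_zero_iff]

/-- The structure of a nonnegative integer matrix whose Gram matrices are killed by an odd-index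
`fpoly`, the first of them being irreducible. -/
lemma exists_tadpole_form {p q : ℕ} (hp : 0 < p) {B : Matrix (Fin p) (Fin q) ℤ}
    (hB : ∀ i j, 0 ≤ B i j) (hirr : ∀ i j, ∃ m : ℕ, 0 < ((B * Bᵀ) ^ m) i j) {K : ℕ}
    (h1 : aeval (B * Bᵀ) (fpoly (2 * K + 1)) = 0)
    (h2 : aeval (Bᵀ * B) (fpoly (2 * K + 1)) = 0) :
    ∃ (v : Fin p ≃ Fin p) (σ : Fin p ≃ Fin q), (∀ i j, B (v i) (σ (v j)) = tadpole i j) ∧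
      (∀ f : Polynomial ℤ, aeval (B * Bᵀ) f = 0 ↔
        aeval (tadpoleMatrix p * tadpoleMatrix p) f = 0) ∧
      ∀ f : Polynomial ℤ, aeval (Bᵀ * B) f = 0 ↔
        aeval (tadpoleMatrix p * tadpoleMatrix p) f = 0 := by
  obtain ⟨σ, hsymm, hodd⟩ := exists_equiv_symm_submatrix hB h1 h2
  set N := B.submatrix id σ with hN
  have hNN : B * Bᵀ = N * N := by
    nth_rewrite 2 [← hsymm]
    ext i j
    simp only [Matrix.mul_apply, Matrix.transpose_apply, hN, Matrix.submatrix_apply, id]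
    exact (Equiv.sum_comp σ fun l => B i l * B j l).symm
  have hBB : Bᵀ * B = Matrix.reindex σ σ (N * N) := by
    nth_rewrite 1 [← hsymm]
    ext i j
    simp [Matrix.mul_apply, hN]
  rw [hNN] at h1 hirr hodd
  have hsub : Subcritical N := fun x hx hx0 => exists_mulVec_lt_two_mul hsymm h1 hx hx0
  obtain ⟨a, ha⟩ : ∃ a, N a a ≠ 0 := by
    by_contra! h0
    exact hodd ⟨0, hp⟩ (even_diag_aeval_mul_self_mul hsymm (by simp [h0]) _ _)
  obtain ⟨k, v, hv⟩ := exists_equiv_tadpole hsub (fun i j => hB _ _) hsymm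
    (fun i j => (hirr i j).imp' (fun m => 2 * m) fun m hm => by rwa [pow_mul, sq]) ha
  obtain rfl : k = p := Fin.equiv_iff_eq.1 ⟨v⟩
  have hT : N * N = Matrix.reindex v v (tadpoleMatrix k * tadpoleMatrix k) := by
    have h : N = Matrix.reindex v v (tadpoleMatrix k) := by
      ext i j
      simpa [tadpoleMatrix] using hv (v.symm i) (v.symm j)
    rw [h]
    simp
  refine ⟨v, σ, hv, fun f => ?_, fun f => ?_⟩
  · rw [hNN, hT, aeval_reindex_eq_zero_iff]
  · rw [hBB, hT, aeval_reindex_eq_zero_iff, aeval_reindex_eq_zero_iff]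

/-- let `B` be a nonzero matrix with nonnegative integer entries with
`B·Bᵀ` and `Bᵀ·B` irreducible, and let `n` be the smallest positive integer with
`fₙ(B·Bᵀ) = 0` and `fₙ(Bᵀ·B) = 0`. If `n` is odd, then `n = 2k+1` with `k ≥ 1`, `B`
is square of size `k×k`, and `B` reduces to the `k×k` staircase matrix by independent
permutations of rows and columns. -/
theorem statement12 {p q : ℕ} (B : Matrix (Fin p) (Fin q) ℝ)
    (hnat : ∀ i j, ∃ m : ℕ, B i j = (m : ℝ)) (hB : B ≠ 0)
    (h1 : IsIrreducibleMat (B * Bᵀ)) (h2 : IsIrreducibleMat (Bᵀ * B))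
    (n : ℕ) (hn : 0 < n)
    (hann : aeval (B * Bᵀ) (fpoly n) = 0 ∧ aeval (Bᵀ * B) (fpoly n) = 0)
    (hmin : ∀ m : ℕ, 0 < m →
      (aeval (B * Bᵀ) (fpoly m) = 0 ∧ aeval (Bᵀ * B) (fpoly m) = 0) → n ≤ m)
    (hodd : n % 2 = 1) :
    ∃ k : ℕ, 1 ≤ k ∧ n = 2 * k + 1 ∧ p = k ∧ q = k ∧ PermEquiv B (stairSq k) := by
  have hp : 0 < p := by
    rcases Nat.eq_zero_or_pos p with rfl | hp
    · exact absurd (Matrix.ext fun i => i.elim0) hB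
    · exact hp
  choose b hb using hnat
  set A : Matrix (Fin p) (Fin q) ℤ := Matrix.of fun i j => (b i j : ℤ) with hA
  have hBA : B = A.map (Int.cast : ℤ → ℝ) := by
    ext i j
    simp [hA, hb]
  have hQ : B * Bᵀ = (A * Aᵀ).map (Int.cast : ℤ → ℝ) := by
    rw [map_intCast_mul, hBA, Matrix.transpose_map]
  have hR : Bᵀ * B = (Aᵀ * A).map (Int.cast : ℤ → ℝ) := by
    rw [map_intCast_mul, hBA, Matrix.transpose_map]
  have hcast {r : ℕ} (C : Matrix (Fin r) (Fin r) ℤ) (f : Polynomial ℤ) :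
      aeval (C.map (Int.cast : ℤ → ℝ)) f = 0 ↔ aeval C f = 0 := by
    rw [aeval_map_intCast, ← Matrix.ext_iff, ← Matrix.ext_iff]
    simp
  have hirr : ∀ i j, ∃ m : ℕ, 0 < ((A * Aᵀ) ^ m) i j := by
    intro i j
    obtain ⟨m, -, hm⟩ := h1 i j
    have hpow : (B * Bᵀ) ^ m = ((A * Aᵀ) ^ m).map (Int.cast : ℤ → ℝ) := by
      simpa [hQ] using aeval_map_intCast (A * Aᵀ) (X ^ m)
    rw [hpow, Matrix.map_apply] at hm
    exact ⟨m, by exact_mod_cast hm⟩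
  simp only [hQ, hR, hcast] at hann hmin
  obtain ⟨K, rfl⟩ : ∃ K, n = 2 * K + 1 := ⟨n / 2, by omega⟩
  obtain ⟨v, σ, hv, hf1, hf2⟩ :=
    exists_tadpole_form hp (fun i j => by simp [hA]) hirr hann.1 hann.2
  obtain rfl : p = q := Fin.equiv_iff_eq.1 ⟨σ⟩
  have hle : 2 * K + 1 ≤ 2 * p + 1 := hmin _ (by omega)
    ⟨(hf1 _).2 (aeval_tadpoleMatrix_eq_zero p), (hf2 _).2 (aeval_tadpoleMatrix_eq_zero p)⟩
  have hge : p ≤ K := by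
    by_contra! hlt
    exact aeval_tadpoleMatrix_ne_zero hlt ((hf1 _).1 hann.1)
  obtain ⟨e, f, hef⟩ := exists_equiv_stairSq p
  refine ⟨p, hp, by omega, rfl, rfl, v.symm.trans e, (v.trans σ).symm.trans f, fun i j => ?_⟩
  have hij := hv (v.symm i) ((v.trans σ).symm j)
  simp only [Equiv.apply_symm_apply, Equiv.symm_trans_apply] at hij
  rw [Equiv.trans_apply, Equiv.trans_apply, ← hef, Equiv.symm_trans_apply, ← hij, hBA,
    Matrix.map_apply]
end

section
/- Let B be a nonzero matrix with nonnegative integer entries such that both B·Bᵀ and Bᵀ·B are irreducible, and suppose n is the smallest positive integer such that f_n(B·Bᵀ) = 0 and f_n(Bᵀ·B) = 0. Assume n is even, n > 4 and n ∉ {12, 18, 30}, and write n = 2k. Then B can be transformed, by a permutation of rows, an independent permutation of columns, and possibly transposition, into one of the following: the k×(k−1) staircase matrix; if k is even, an extended staircase matrix of size (k/2)×((k+2)/2); if k is odd, an extended staircase matrix of size ((k+3)/2)×((k−1)/2). -/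
open Matrix Polynomial

/-- The `k × (k+1)` staircase matrix: entry `1` exactly when `j = i` or `j = i + 1`;
its transpose `(stairRect (k-1))ᵀ` is the `k×(k−1)` staircase matrix with entry `1`
exactly when `j = i − 1` or `j = i`. -/
def stairRect (k : ℕ) : Matrix (Fin k) (Fin (k + 1)) ℝ :=
  Matrix.of fun i j => if (j : ℕ) = (i : ℕ) ∨ (j : ℕ) = (i : ℕ) + 1 then 1 else 0

/-- The `(k+1) × k` matrix with rows `e₁+e₂, e₂+e₃, …, e_{k−1}+e_k, e_k, e_k`
(written `0`-indexed). -/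
def extA (k : ℕ) : Matrix (Fin (k + 1)) (Fin k) ℝ :=
  Matrix.of fun i j =>
    if ((i : ℕ) + 1 < k ∧ ((j : ℕ) = (i : ℕ) ∨ (j : ℕ) = (i : ℕ) + 1)) ∨
       (k ≤ (i : ℕ) + 1 ∧ (j : ℕ) + 1 = k) then 1 else 0

/-- The `k × (k+2)` matrix with rows `e₁+e₂, e₂+e₃, …, e_{k−1}+e_k, e_k+e_{k+1}+e_{k+2}`
(written `0`-indexed). -/
def extB (k : ℕ) : Matrix (Fin k) (Fin (k + 2)) ℝ :=
  Matrix.of fun i j =>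
    if ((i : ℕ) + 1 < k ∧ ((j : ℕ) = (i : ℕ) ∨ (j : ℕ) = (i : ℕ) + 1)) ∨
       ((i : ℕ) + 1 = k ∧ ((j : ℕ) + 1 = k ∨ (j : ℕ) = k ∨ (j : ℕ) = k + 1)) then 1 else 0

/-- `X` is an extended staircase matrix: it is obtained from `extA k` or `extB k` by
permutations of rows, permutations of columns and/or transposition. -/
def IsExtStaircase {p q : ℕ} (X : Matrix (Fin p) (Fin q) ℝ) : Prop :=
  ∃ k : ℕ, 1 ≤ k ∧
    (PermEquiv X (extA k) ∨ PermEquiv X (extA k)ᵀ ∨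
     PermEquiv X (extB k) ∨ PermEquiv X (extB k)ᵀ)

namespace BipartiteDynkin

section CoxeterNumber

variable {V W : Type*} [Fintype V] [DecidableEq V] [Fintype W] [DecidableEq W]

/-- The sequence `S₀ = 0`, `S₁ = 1`, `Sₙ₊₂ = M Sₙ₊₁ - Sₙ` of Chebyshev polynomials
evaluated at the matrix `M`. -/
def chebSeq (M : Matrix V V ℝ) : ℕ → Matrix V V ℝ
  | 0 => 0
  | 1 => 1
  | n + 2 => M * chebSeq M (n + 1) - chebSeq M n

lemma chebSeq_comm (M : Matrix V V ℝ) (n : ℕ) : M * chebSeq M n = chebSeq M n * M := by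
  induction n using Nat.twoStepInduction with
  | zero => simp [chebSeq]
  | one => simp [chebSeq]
  | more n h0 h1 => rw [chebSeq, mul_sub, sub_mul, h0, Matrix.mul_assoc, ← h1]

lemma chebSeq_submatrix (M : Matrix V V ℝ) (e : W ≃ V) (n : ℕ) :
    chebSeq (M.submatrix e e) n = (chebSeq M n).submatrix e e := by
  induction n using Nat.twoStepInduction with
  | zero => simp [chebSeq]
  | one => simp [chebSeq]
  | more n h0 h1 =>
    simp only [chebSeq, h0, h1, Matrix.submatrix_mul_equiv]
    rfl

lemma chebSeq_mulVec {M : Matrix V V ℝ} {h : ℕ} {Y : ℕ → V → ℝ} (hY0 : Y 0 = 0)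
    (hY : ∀ j, j + 2 ≤ h → M *ᵥ Y (j + 1) = Y (j + 2) + Y j) {j : ℕ} (hj : j ≤ h) :
    chebSeq M j *ᵥ Y 1 = Y j := by
  induction j using Nat.twoStepInduction with
  | zero => simp [chebSeq, hY0]
  | one => simp [chebSeq]
  | more n h0 h1 =>
    rw [chebSeq, Matrix.sub_mulVec, ← Matrix.mulVec_mulVec, h0 (by omega), h1 (by omega),
      hY n hj, add_sub_cancel_right]

lemma chebSeq_mulVec_of_mulVec_eq_zero {M : Matrix V V ℝ} {x : V → ℝ} (hx : M *ᵥ x = 0)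
    (n : ℕ) : chebSeq M (2 * n) *ᵥ x = 0 := by
  induction n with
  | zero => simp [chebSeq]
  | succ n ih =>
    rw [show 2 * (n + 1) = 2 * n + 2 by ring, chebSeq, chebSeq_comm, Matrix.sub_mulVec,
      ← Matrix.mulVec_mulVec, hx, ih]
    simp

/-- `h` is the least positive index at which `chebSeq M` vanishes, where moreover
`M * chebSeq M j` is nonzero at all smaller positive indices. -/
def IsCoxeterNumber (M : Matrix V V ℝ) (h : ℕ) : Prop :=
  chebSeq M h = 0 ∧ ∀ j, 0 < j → j < h → M * chebSeq M j ≠ 0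

lemma IsCoxeterNumber.of_submatrix {M : Matrix V V ℝ} {e : W ≃ V} {h : ℕ}
    (hM : IsCoxeterNumber (M.submatrix e e) h) : IsCoxeterNumber M h := by
  refine ⟨?_, fun j h0 hj h => hM.2 j h0 hj ?_⟩
  · have := hM.1
    rw [chebSeq_submatrix] at this
    ext a b
    simpa using congrFun₂ this (e.symm a) (e.symm b)
  · rw [chebSeq_submatrix, Matrix.submatrix_mul_equiv, h]
    rfl

/-- The subspace annihilated by `chebSeq M h`. -/
def chebKer (M : Matrix V V ℝ) (h : ℕ) : Submodule ℝ (V → ℝ) :=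
  LinearMap.ker (chebSeq M h).mulVecLin

lemma mem_chebKer {M : Matrix V V ℝ} {h : ℕ} {x : V → ℝ} :
    x ∈ chebKer M h ↔ chebSeq M h *ᵥ x = 0 := by
  simp [chebKer]

lemma mulVec_mem_chebKer {M : Matrix V V ℝ} {h : ℕ} {x : V → ℝ} (hx : x ∈ chebKer M h) :
    M *ᵥ x ∈ chebKer M h := by
  rw [mem_chebKer] at *
  rw [Matrix.mulVec_mulVec, ← chebSeq_comm, ← Matrix.mulVec_mulVec, hx, Matrix.mulVec_zero]

/-- A nonnegative solution of the Chebyshev recursion whose first return to zero is at `h`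
certifies that `h` is the Coxeter number. -/
lemma IsCoxeterNumber.of_certificate {M : Matrix V V ℝ} {h : ℕ} (h3 : 3 ≤ h)
    {Y : ℕ → V → ℝ} (hY0 : Y 0 = 0) (hYh : Y h = 0)
    (hY : ∀ j, j + 2 ≤ h → M *ᵥ Y (j + 1) = Y (j + 2) + Y j)
    (hnn : ∀ j, j ≤ h → 0 ≤ Y j) (hne : ∀ j, 0 < j → j < h → Y j ≠ 0)
    (hspan : Y 1 ∈ chebKer M h → ∀ v, Pi.single v 1 ∈ chebKer M h) :
    IsCoxeterNumber M h := by
  constructor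
  · have h1 : Y 1 ∈ chebKer M h := by rw [mem_chebKer, chebSeq_mulVec hY0 hY le_rfl, hYh]
    ext a b
    have := hspan h1 b
    rw [mem_chebKer, Matrix.mulVec_single_one] at this
    exact congrFun this a
  · intro j h0 hj hz
    obtain ⟨j, rfl⟩ : ∃ i, j = i + 1 := ⟨j - 1, by omega⟩
    have h1 : Y (j + 2) + Y j = 0 := by
      rw [← hY j (by omega), ← chebSeq_mulVec hY0 hY hj.le, Matrix.mulVec_mulVec, hz,
        Matrix.zero_mulVec]
    have h2 := (add_eq_zero_iff_of_nonneg (hnn (j + 2) (by omega)) (hnn j (by omega))).1 h1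
    rcases Nat.eq_zero_or_pos j with rfl | hpos
    · exact hne 2 (by omega) (by omega) h2.1
    · exact hne j hpos (by omega) h2.2

section Paths

/-- The indicator vector of the coordinate preceding `j`; it vanishes at `j = 0`. -/
def shiftedBasis (N j : ℕ) : Fin N → ℝ := fun a => if (a : ℕ) + 1 = j then 1 else 0

lemma shiftedBasis_zero (N : ℕ) : shiftedBasis N 0 = 0 := by
  ext a; simp [shiftedBasis]

lemma shiftedBasis_of_lt {N j : ℕ} (h : N < j) : shiftedBasis N j = 0 := by
  ext a; simp [shiftedBasis]; omega

lemma shiftedBasis_nonneg (N j : ℕ) : 0 ≤ shiftedBasis N j := by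
  intro a; simp only [shiftedBasis, Pi.zero_apply]; split_ifs <;> norm_num

lemma shiftedBasis_ne_zero {N j : ℕ} (h0 : 0 < j) (hj : j ≤ N) : shiftedBasis N j ≠ 0 := by
  intro h
  have := congrFun h ⟨j - 1, by omega⟩
  simp only [shiftedBasis, Pi.zero_apply, ite_eq_right_iff, one_ne_zero, imp_false] at this
  omega

lemma shiftedBasis_succ {N : ℕ} (v : Fin N) : shiftedBasis N (v + 1) = Pi.single v 1 := by
  ext a; simp [shiftedBasis, Pi.single_apply, Fin.ext_iff]

lemma mulVec_shiftedBasis {N : ℕ} (M : Matrix (Fin N) (Fin N) ℝ) {j : ℕ} (hj : j < N) :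
    M *ᵥ shiftedBasis N (j + 1) = fun a => M a ⟨j, hj⟩ := by
  rw [show j + 1 = ((⟨j, hj⟩ : Fin N) : ℕ) + 1 from rfl, shiftedBasis_succ,
    Matrix.mulVec_single_one]
  rfl

/-- The adjacency matrix of a path, the Dynkin diagram of type `A`. -/
def pathMatrix (N : ℕ) : Matrix (Fin N) (Fin N) ℝ :=
  Matrix.of fun a b => if (a : ℕ) + 1 = b ∨ (b : ℕ) + 1 = a then 1 else 0

lemma pathMatrix_mulVec {N j : ℕ} (hj : j < N) :
    pathMatrix N *ᵥ shiftedBasis N (j + 1) = shiftedBasis N (j + 2) + shiftedBasis N j := by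
  rw [mulVec_shiftedBasis _ hj]
  ext a
  simp only [pathMatrix, Matrix.of_apply, shiftedBasis, Pi.add_apply]
  split_ifs <;> first | omega | norm_num

lemma isCoxeterNumber_pathMatrix {N : ℕ} (hN : 2 ≤ N) :
    IsCoxeterNumber (pathMatrix N) (N + 1) := by
  refine .of_certificate (by omega) (Y := shiftedBasis N) (shiftedBasis_zero N)
    (shiftedBasis_of_lt (by omega)) (fun j hj => pathMatrix_mulVec (by omega))
    (fun j _ => shiftedBasis_nonneg N j) (fun j h0 hj => shiftedBasis_ne_zero h0 (by omega)) ?_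
  intro h1 v
  have key : ∀ j, shiftedBasis N j ∈ chebKer (pathMatrix N) (N + 1) := by
    intro j
    induction j using Nat.twoStepInduction with
    | zero => rw [shiftedBasis_zero]; exact Submodule.zero_mem _
    | one => exact h1
    | more j h0 h1 =>
      rcases lt_or_ge j N with hj | hj
      · rw [← (Submodule.add_mem_iff_left _ h0), ← pathMatrix_mulVec hj]
        exact mulVec_mem_chebKer h1
      · rw [shiftedBasis_of_lt (by omega)]; exact Submodule.zero_mem _
  rw [← shiftedBasis_succ]
  exact key _

/-- Vertices `0, …, m` form a path and the vertex `m + 1` is joined to `i`. -/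
def BranchAdj (m i a b : ℕ) : Prop :=
  (a + 1 = b ∧ b ≤ m) ∨ (b + 1 = a ∧ a ≤ m) ∨ (a = i ∧ b = m + 1) ∨ (b = i ∧ a = m + 1)

instance (m i a b : ℕ) : Decidable (BranchAdj m i a b) := by
  unfold BranchAdj; infer_instance

/-- The adjacency matrix of a path `0, …, m` with one more vertex attached to `i`. -/
def branchMatrix (m i : ℕ) : Matrix (Fin (m + 2)) (Fin (m + 2)) ℝ :=
  Matrix.of fun a b => if BranchAdj m i a b then 1 else 0

lemma branchMatrix_mulVec {m i j : ℕ} (hj : j < m) (hji : j ≠ i) :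
    branchMatrix m i *ᵥ shiftedBasis (m + 2) (j + 1) =
      shiftedBasis (m + 2) (j + 2) + shiftedBasis (m + 2) j := by
  rw [mulVec_shiftedBasis _ (by omega)]
  ext a
  by_cases h : BranchAdj m i a j <;>
    simp only [branchMatrix, Matrix.of_apply, shiftedBasis, Pi.add_apply, h, if_true, if_false] <;>
    unfold BranchAdj at h <;> split_ifs <;> first | omega | norm_num

lemma branchMatrix_mulVec_branch {m i : ℕ} (hi : i < m) :
    branchMatrix m i *ᵥ shiftedBasis (m + 2) (i + 1) =
      shiftedBasis (m + 2) (i + 2) + shiftedBasis (m + 2) (m + 2) + shiftedBasis (m + 2) i := by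
  rw [mulVec_shiftedBasis _ (by omega)]
  ext a
  by_cases h : BranchAdj m i a i <;>
    simp only [branchMatrix, Matrix.of_apply, shiftedBasis, Pi.add_apply, h, if_true, if_false] <;>
    unfold BranchAdj at h <;> split_ifs <;> first | omega | norm_num

lemma branchMatrix_mulVec_end {m i : ℕ} (hi : i < m) :
    branchMatrix m i *ᵥ shiftedBasis (m + 2) (m + 1) = shiftedBasis (m + 2) m := by
  rw [mulVec_shiftedBasis _ (by omega)]
  ext a
  by_cases h : BranchAdj m i a m <;>
    simp only [branchMatrix, Matrix.of_apply, shiftedBasis, h, if_true, if_false] <;>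
    unfold BranchAdj at h <;> split_ifs <;> first | omega | norm_num

lemma branchMatrix_mulVec_leaf {m i : ℕ} (hi : i < m) :
    branchMatrix m i *ᵥ shiftedBasis (m + 2) (m + 2) = shiftedBasis (m + 2) (i + 1) := by
  rw [mulVec_shiftedBasis _ (by omega)]
  ext a
  by_cases h : BranchAdj m i a (m + 1) <;>
    simp only [branchMatrix, Matrix.of_apply, shiftedBasis, h, if_true, if_false] <;>
    unfold BranchAdj at h <;> split_ifs <;> first | omega | norm_num

lemma shiftedBasis_mem_chebKer {m i h : ℕ} (hi : i < m)
    (h1 : shiftedBasis (m + 2) 1 ∈ chebKer (branchMatrix m i) h) {j : ℕ} (hj : j ≤ i + 1) :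
    shiftedBasis (m + 2) j ∈ chebKer (branchMatrix m i) h := by
  induction j using Nat.twoStepInduction with
  | zero => rw [shiftedBasis_zero]; exact Submodule.zero_mem _
  | one => exact h1
  | more j h0 h1 =>
    rw [← (Submodule.add_mem_iff_left _ (h0 (by omega))),
      ← branchMatrix_mulVec (i := i) (by omega) (by omega)]
    exact mulVec_mem_chebKer (h1 (by omega))

lemma single_mem_chebKer {m i h : ℕ}
    (hmem : ∀ j, 0 < j → j ≤ m + 2 → shiftedBasis (m + 2) j ∈ chebKer (branchMatrix m i) h)
    (v : Fin (m + 2)) : Pi.single v 1 ∈ chebKer (branchMatrix m i) h := by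
  rw [← shiftedBasis_succ]
  exact hmem _ (by omega) (by omega)

lemma add_mem_chebKer_branch {m i h : ℕ} (hi : i < m)
    (h1 : shiftedBasis (m + 2) 1 ∈ chebKer (branchMatrix m i) h) :
    shiftedBasis (m + 2) (i + 2) + shiftedBasis (m + 2) (m + 2) ∈
      chebKer (branchMatrix m i) h := by
  rw [← Submodule.add_mem_iff_left _ (shiftedBasis_mem_chebKer hi h1 (Nat.le_succ i)),
    ← branchMatrix_mulVec_branch hi]
  exact mulVec_mem_chebKer (shiftedBasis_mem_chebKer hi h1 le_rfl)

/-- The Coxeter number of the Dynkin diagram of type `D` on `i + 3` vertices. -/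
lemma isCoxeterNumber_branchMatrix_one (i : ℕ) :
    IsCoxeterNumber (branchMatrix (i + 1) i) (2 * (i + 2)) := by
  set b := shiftedBasis (i + 1 + 2) with hb
  let Y : ℕ → Fin (i + 1 + 2) → ℝ := fun j =>
    if j ≤ i + 1 then b j else if j = i + 2 then b (i + 2) + b (i + 3) else b (2 * (i + 2) - j)
  have hY1 : ∀ j, j ≤ i + 1 → Y j = b j := fun j hj => if_pos hj
  have hY2 : Y (i + 2) = b (i + 2) + b (i + 3) := by simp [Y]
  have hY3 : ∀ j k, i + 2 < j → j + k = 2 * (i + 2) → Y j = b k := by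
    intro j k hj hk
    simp only [Y]
    rw [if_neg (by omega), if_neg (by omega)]
    congr 1; omega
  refine .of_certificate (by omega) (Y := Y) ?_ ?_ ?_ ?_ ?_ ?_
  · rw [hY1 0 (by omega), hb, shiftedBasis_zero]
  · rw [hY3 _ 0 (by omega) (by omega), hb, shiftedBasis_zero]
  · intro j hj
    rcases lt_trichotomy j i with h | rfl | h
    · rw [hY1 (j + 1) (by omega), hY1 (j + 2) (by omega), hY1 j (by omega)]
      exact branchMatrix_mulVec (by omega) (by omega)
    · rw [hY1 (j + 1) le_rfl, hY1 j (by omega), hY2]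
      exact branchMatrix_mulVec_branch (by omega)
    · rcases Nat.lt_or_ge j (i + 2) with h' | h'
      · obtain rfl : j = i + 1 := by omega
        rw [hY2, hY3 (i + 1 + 2) (i + 1) (by omega) (by omega), hY1 _ le_rfl,
          Matrix.mulVec_add, hb, branchMatrix_mulVec_end (Nat.lt_succ_self i),
          branchMatrix_mulVec_leaf (Nat.lt_succ_self i)]
      · obtain ⟨k, hk⟩ : ∃ k, j + k + 2 = 2 * (i + 2) := ⟨2 * (i + 2) - j - 2, by omega⟩
        rw [hY3 (j + 1) (k + 1) (by omega) (by omega), hY3 (j + 2) k (by omega) (by omega)]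
        rcases Nat.lt_or_ge (i + 2) j with h'' | h''
        · rw [hY3 j (k + 2) (by omega) (by omega), add_comm (b k)]
          exact branchMatrix_mulVec (by omega) (by omega)
        · obtain rfl : j = i + 2 := by omega
          obtain rfl : k = i := by omega
          rw [hY2, add_comm (b k)]
          exact branchMatrix_mulVec_branch (by omega)
  · intro j _
    simp only [Y]
    split_ifs
    · exact shiftedBasis_nonneg _ _
    · exact add_nonneg (shiftedBasis_nonneg _ _) (shiftedBasis_nonneg _ _)
    · exact shiftedBasis_nonneg _ _
  · intro j h0 hj
    simp only [Y]
    split_ifs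
    · exact shiftedBasis_ne_zero h0 (by omega)
    · intro h
      exact shiftedBasis_ne_zero (by omega) (by omega)
        ((add_eq_zero_iff_of_nonneg (shiftedBasis_nonneg _ _) (shiftedBasis_nonneg _ _)).1 h).1
    · exact shiftedBasis_ne_zero (by omega) (by omega)
  · rw [hY1 1 (by omega)]
    intro h1
    have hsum := add_mem_chebKer_branch (Nat.lt_succ_self i) h1
    have hdiff : b (i + 2) - b (i + 3) ∈ chebKer (branchMatrix (i + 1) i) (2 * (i + 2)) := by
      rw [mem_chebKer]
      apply chebSeq_mulVec_of_mulVec_eq_zero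
      rw [Matrix.mulVec_sub, hb, branchMatrix_mulVec_end (Nat.lt_succ_self i),
          branchMatrix_mulVec_leaf (Nat.lt_succ_self i), sub_self]
    apply single_mem_chebKer
    intro j _ hj
    rcases Nat.lt_or_ge j (i + 2) with h | h
    · exact shiftedBasis_mem_chebKer (Nat.lt_succ_self i) h1 (by omega)
    · rcases Nat.lt_or_ge j (i + 3) with h' | h'
      · obtain rfl : j = i + 2 := by omega
        have : b (i + 2) = (2⁻¹ : ℝ) • ((b (i + 2) + b (i + 3)) + (b (i + 2) - b (i + 3))) := by
          ext a
          simp only [Pi.smul_apply, Pi.add_apply, Pi.sub_apply, smul_eq_mul]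
          ring
        rw [← hb, this]
        exact Submodule.smul_mem _ _ (Submodule.add_mem _ hsum hdiff)
      · obtain rfl : j = i + 3 := by omega
        have : b (i + 3) = (2⁻¹ : ℝ) • ((b (i + 2) + b (i + 3)) - (b (i + 2) - b (i + 3))) := by
          ext a
          simp only [Pi.smul_apply, Pi.add_apply, Pi.sub_apply, smul_eq_mul]
          ring
        rw [← hb, this]
        exact Submodule.smul_mem _ _ (Submodule.sub_mem _ hsum hdiff)

/-- In a diagram of type `E` the vector at the end of the long arm is cyclic. -/
lemma single_mem_chebKer_of_two {i h : ℕ}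
    (h1 : shiftedBasis (i + 2 + 2) 1 ∈ chebKer (branchMatrix (i + 2) i) h) (v : Fin (i + 2 + 2)) :
    Pi.single v 1 ∈ chebKer (branchMatrix (i + 2) i) h := by
  have hi : i < i + 2 := by omega
  have hlow := fun j (hj : j ≤ i + 1) => shiftedBasis_mem_chebKer hi h1 hj
  have hsum := add_mem_chebKer_branch hi h1
  have h3 : shiftedBasis (i + 2 + 2) (i + 3) ∈ chebKer (branchMatrix (i + 2) i) h := by
    have := mulVec_mem_chebKer hsum
    rw [Matrix.mulVec_add, branchMatrix_mulVec (j := i + 1) (by omega) (by omega),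
      branchMatrix_mulVec_leaf hi, Submodule.add_mem_iff_left _ (hlow _ le_rfl),
      Submodule.add_mem_iff_left _ (hlow _ le_rfl)] at this
    exact this
  have h2 : shiftedBasis (i + 2 + 2) (i + 2) ∈ chebKer (branchMatrix (i + 2) i) h := by
    rw [← branchMatrix_mulVec_end hi]
    exact mulVec_mem_chebKer h3
  apply single_mem_chebKer
  intro j _ hj
  rcases Nat.lt_or_ge j (i + 2) with h | h
  · exact hlow _ (by omega)
  · obtain rfl | rfl | rfl : j = i + 2 ∨ j = i + 3 ∨ j = i + 4 := by omega
    · exact h2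
    · exact h3
    · exact (Submodule.add_mem_iff_right _ h2).1 hsum

end Paths

section Exceptional

/-- The integral version of `branchMatrix`. -/
def branchMatrixInt (m i : ℕ) : Matrix (Fin (m + 2)) (Fin (m + 2)) ℤ :=
  Matrix.of fun a b => if BranchAdj m i a b then 1 else 0

lemma branchMatrixInt_map (m i : ℕ) :
    (branchMatrixInt m i).map (Int.castRingHom ℝ) = branchMatrix m i := by
  ext a b
  simp only [branchMatrixInt, branchMatrix, Matrix.map_apply, Matrix.of_apply]
  split_ifs <;> simp

/-- The vector stored in row `j` of a table of integers. -/
def tableRow (N : ℕ) (T : List (List ℤ)) (j : ℕ) : Fin N → ℤ :=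
  fun a => (T.getD j []).getD a 0

/-- A table of integers certifying a Coxeter number. -/
lemma isCoxeterNumber_of_table {i h : ℕ} (h3 : 3 ≤ h) (T : List (List ℤ))
    (h0 : tableRow (i + 2 + 2) T 0 = 0)
    (h1 : ∀ a : Fin (i + 2 + 2), tableRow (i + 2 + 2) T 1 a = if (a : ℕ) = 0 then 1 else 0)
    (hh : tableRow (i + 2 + 2) T h = 0)
    (hT : ∀ j < h - 1, branchMatrixInt (i + 2) i *ᵥ tableRow (i + 2 + 2) T (j + 1) =
      tableRow (i + 2 + 2) T (j + 2) + tableRow (i + 2 + 2) T j)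
    (hnn : ∀ j < h + 1, ∀ a, 0 ≤ tableRow (i + 2 + 2) T j a)
    (hne : ∀ j < h, 0 < j → ∃ a, tableRow (i + 2 + 2) T j a ≠ 0) :
    IsCoxeterNumber (branchMatrix (i + 2) i) h := by
  refine .of_certificate h3 (Y := fun j a => (tableRow (i + 2 + 2) T j a : ℝ)) ?_ ?_ ?_ ?_ ?_ ?_
  · ext a; simp [h0]
  · ext a; simp [hh]
  · intro j hj
    ext a
    have := congrArg (Int.castRingHom ℝ) (congrFun (hT j (by omega)) a)
    rw [RingHom.map_mulVec, branchMatrixInt_map] at this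
    simpa [Function.comp_def] using this
  · intro j hj a
    exact Int.cast_nonneg (hnn j (by omega) a)
  · intro j hpos hj h
    obtain ⟨a, ha⟩ := hne j hj hpos
    exact ha (Int.cast_eq_zero.1 (congrFun h a))
  · have : (fun a => (tableRow (i + 2 + 2) T 1 a : ℝ)) = shiftedBasis (i + 2 + 2) 1 := by
      ext a
      simp [h1, shiftedBasis]
    rw [this]
    exact single_mem_chebKer_of_two

set_option maxRecDepth 100000 in
/-- The Coxeter number of the Dynkin diagram of type `E` on six vertices. -/
lemma isCoxeterNumber_E_six : IsCoxeterNumber (branchMatrix 4 2) 12 := by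
  apply isCoxeterNumber_of_table (i := 2) (by norm_num)
    [[0, 0, 0, 0, 0, 0], [1, 0, 0, 0, 0, 0], [0, 1, 0, 0, 0, 0], [0, 0, 1, 0, 0, 0],
     [0, 0, 0, 1, 0, 1], [0, 0, 1, 0, 1, 0], [0, 1, 0, 1, 0, 0], [1, 0, 1, 0, 0, 0],
     [0, 1, 0, 0, 0, 1], [0, 0, 1, 0, 0, 0], [0, 0, 0, 1, 0, 0], [0, 0, 0, 0, 1, 0],
     [0, 0, 0, 0, 0, 0]] <;>
  decide

set_option maxRecDepth 100000 in
/-- The Coxeter number of the Dynkin diagram of type `E` on seven vertices. -/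
lemma isCoxeterNumber_E_seven : IsCoxeterNumber (branchMatrix 5 3) 18 := by
  apply isCoxeterNumber_of_table (i := 3) (by norm_num)
    [[0, 0, 0, 0, 0, 0, 0], [1, 0, 0, 0, 0, 0, 0], [0, 1, 0, 0, 0, 0, 0], [0, 0, 1, 0, 0, 0, 0],
     [0, 0, 0, 1, 0, 0, 0], [0, 0, 0, 0, 1, 0, 1], [0, 0, 0, 1, 0, 1, 0], [0, 0, 1, 0, 1, 0, 0],
     [0, 1, 0, 1, 0, 0, 0], [1, 0, 1, 0, 0, 0, 1], [0, 1, 0, 1, 0, 0, 0], [0, 0, 1, 0, 1, 0, 0],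
     [0, 0, 0, 1, 0, 1, 0], [0, 0, 0, 0, 1, 0, 1], [0, 0, 0, 1, 0, 0, 0], [0, 0, 1, 0, 0, 0, 0],
     [0, 1, 0, 0, 0, 0, 0], [1, 0, 0, 0, 0, 0, 0], [0, 0, 0, 0, 0, 0, 0]] <;>
  decide

set_option maxRecDepth 100000 in
/-- The Coxeter number of the Dynkin diagram of type `E` on eight vertices. -/
lemma isCoxeterNumber_E_eight : IsCoxeterNumber (branchMatrix 6 4) 30 := by
  apply isCoxeterNumber_of_table (i := 4) (by norm_num)
    [[0, 0, 0, 0, 0, 0, 0, 0], [1, 0, 0, 0, 0, 0, 0, 0], [0, 1, 0, 0, 0, 0, 0, 0],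
     [0, 0, 1, 0, 0, 0, 0, 0], [0, 0, 0, 1, 0, 0, 0, 0], [0, 0, 0, 0, 1, 0, 0, 0],
     [0, 0, 0, 0, 0, 1, 0, 1], [0, 0, 0, 0, 1, 0, 1, 0], [0, 0, 0, 1, 0, 1, 0, 0],
     [0, 0, 1, 0, 1, 0, 0, 0], [0, 1, 0, 1, 0, 0, 0, 1], [1, 0, 1, 0, 1, 0, 0, 0],
     [0, 1, 0, 1, 0, 1, 0, 0], [0, 0, 1, 0, 1, 0, 1, 0], [0, 0, 0, 1, 0, 1, 0, 1],
     [0, 0, 0, 0, 2, 0, 0, 0], [0, 0, 0, 1, 0, 1, 0, 1], [0, 0, 1, 0, 1, 0, 1, 0],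
     [0, 1, 0, 1, 0, 1, 0, 0], [1, 0, 1, 0, 1, 0, 0, 0], [0, 1, 0, 1, 0, 0, 0, 1],
     [0, 0, 1, 0, 1, 0, 0, 0], [0, 0, 0, 1, 0, 1, 0, 0], [0, 0, 0, 0, 1, 0, 1, 0],
     [0, 0, 0, 0, 0, 1, 0, 1], [0, 0, 0, 0, 1, 0, 0, 0], [0, 0, 0, 1, 0, 0, 0, 0],
     [0, 0, 1, 0, 0, 0, 0, 0], [0, 1, 0, 0, 0, 0, 0, 0], [1, 0, 0, 0, 0, 0, 0, 0],
     [0, 0, 0, 0, 0, 0, 0, 0]] <;>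
  decide

end Exceptional

end CoxeterNumber

section Classification

variable {V : Type*} [Fintype V]

/-- The adjacency matrix of a connected loopless multigraph whose Tits form is positive. -/
structure IsDynkin (G : Matrix V V ℝ) : Prop where
  symm : ∀ u v, G u v = G v u
  nat : ∀ u v, ∃ n : ℕ, G u v = n
  diag : ∀ v, G v v = 0
  pos : ∀ x : V → ℝ, x ≠ 0 → x ⬝ᵥ G *ᵥ x < 2 * (x ⬝ᵥ x)
  conn : ∀ U : Set V, U.Nonempty → (∀ u ∈ U, ∀ v, G u v ≠ 0 → v ∈ U) → U = Set.univ

namespace IsDynkin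

variable {G : Matrix V V ℝ} (hG : IsDynkin G)
include hG

lemma nonneg (u v : V) : 0 ≤ G u v := by
  obtain ⟨n, hn⟩ := hG.nat u v
  simp [hn]

lemma one_le {u v : V} (h : G u v ≠ 0) : 1 ≤ G u v := by
  obtain ⟨n, hn⟩ := hG.nat u v
  rw [hn] at h ⊢
  exact_mod_cast Nat.one_le_iff_ne_zero.2 (by exact_mod_cast h)

lemma ne_of_ne_zero {u v : V} (h : G u v ≠ 0) : u ≠ v := by
  rintro rfl
  exact h (hG.diag u)

lemma symm_ne {u v : V} (h : G u v ≠ 0) : G v u ≠ 0 := by rwa [hG.symm]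

/-- There is no nonzero nonnegative vector `x` with `2 x ≤ G x` on its support. -/
lemma not_superharmonic (x : V → ℝ) (hx : 0 ≤ x) (hne : x ≠ 0)
    (h : ∀ v, x v ≠ 0 → 2 * x v ≤ (G *ᵥ x) v) : False := by
  refine (hG.pos x hne).not_ge ?_
  rw [dotProduct, dotProduct, Finset.mul_sum]
  refine Finset.sum_le_sum fun v _ => ?_
  by_cases hv : x v = 0
  · simp [hv]
  · have h1 := mul_le_mul_of_nonneg_left (h v hv) (hx v)
    linarith

lemma sum_le_mulVec {x : V → ℝ} (hx : 0 ≤ x) {v : V} (s : Finset V)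
    (h : ∀ u ∈ s, G v u ≠ 0) : ∑ u ∈ s, x u ≤ (G *ᵥ x) v := by
  rw [mulVec, dotProduct]
  calc ∑ u ∈ s, x u ≤ ∑ u ∈ s, G v u * x u :=
        Finset.sum_le_sum fun u hu => le_mul_of_one_le_left (hx u) (hG.one_le (h u hu))
    _ ≤ ∑ u, G v u * x u := Finset.sum_le_sum_of_subset_of_nonneg (Finset.subset_univ s)
        fun u _ _ => mul_nonneg (hG.nonneg v u) (hx u)

lemma eq_one {u v : V} (h : G u v ≠ 0) : G u v = 1 := by
  obtain ⟨n, hn⟩ := hG.nat u v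
  classical
  by_contra h1
  have h2 : (2 : ℝ) ≤ G u v := by
    rw [hn] at h h1 ⊢
    norm_cast at *
    omega
  have huv := hG.ne_of_ne_zero h
  refine (hG.pos (Pi.single u 1 + Pi.single v 1) ?_).not_ge ?_
  · intro h0
    simpa [huv] using congrFun h0 u
  · simp only [Matrix.mulVec_add, Matrix.mulVec_single_one, dotProduct_add, add_dotProduct,
      single_one_dotProduct, Matrix.col_apply, hG.diag, hG.symm v u, Pi.single_apply, huv,
      huv.symm, if_true, if_false]
    linarith

/-- There is no nonempty set of vertices each of which has two neighbours in it. -/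
lemma not_cycle (S : Set V) (hS : S.Nonempty)
    (h : ∀ v ∈ S, ∃ a ∈ S, ∃ b ∈ S, a ≠ b ∧ G v a ≠ 0 ∧ G v b ≠ 0) : False := by
  classical
  refine hG.not_superharmonic (fun v => if v ∈ S then 1 else 0) ?_ ?_ ?_
  · intro v; dsimp only [Pi.zero_apply]; split_ifs <;> norm_num
  · intro h0
    obtain ⟨v, hv⟩ := hS
    simpa [hv] using congrFun h0 v
  · intro v hv
    replace hv : v ∈ S := by simpa using hv
    obtain ⟨a, ha, b, hb, hab, hva, hvb⟩ := h v hv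
    refine le_trans (le_of_eq ?_) (hG.sum_le_mulVec ?_ {a, b} (by simp [hva, hvb]))
    · rw [Finset.sum_pair hab]; simp [hv, ha, hb]; norm_num
    · intro v; dsimp only [Pi.zero_apply]; split_ifs <;> norm_num

/-- There is no subgraph of extended type `D`: inner vertices `C` and leaves `L`. -/
lemma not_extended_D (C L : Set V) (hC : C.Nonempty) (hdisj : Disjoint C L)
    (hL : ∀ v ∈ L, ∃ a ∈ C, G v a ≠ 0)
    (h : ∀ v ∈ C, (∃ a ∈ C, ∃ b ∈ C, a ≠ b ∧ G v a ≠ 0 ∧ G v b ≠ 0) ∨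
      (∃ a ∈ C, ∃ b ∈ L, ∃ c ∈ L, b ≠ c ∧ G v a ≠ 0 ∧ G v b ≠ 0 ∧ G v c ≠ 0) ∨
      (∃ a ∈ L, ∃ b ∈ L, ∃ c ∈ L, ∃ d ∈ L, a ≠ b ∧ a ≠ c ∧ a ≠ d ∧ b ≠ c ∧ b ≠ d ∧ c ≠ d ∧
        G v a ≠ 0 ∧ G v b ≠ 0 ∧ G v c ≠ 0 ∧ G v d ≠ 0)) : False := by
  classical
  have hLC : ∀ v ∈ L, v ∉ C := fun v hv hv' => Set.disjoint_left.1 hdisj hv' hv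
  set x : V → ℝ := fun v => if v ∈ C then 2 else if v ∈ L then 1 else 0 with hx
  have hxC : ∀ v ∈ C, x v = 2 := fun v hv => by simp [hx, hv]
  have hxL : ∀ v ∈ L, x v = 1 := fun v hv => by simp [hx, hv, hLC v hv]
  have hx0 : 0 ≤ x := by
    intro v; simp only [hx, Pi.zero_apply]; split_ifs <;> norm_num
  refine hG.not_superharmonic x hx0 ?_ ?_
  · intro h0
    obtain ⟨v, hv⟩ := hC
    have := congrFun h0 v
    simp [hxC v hv] at this
  · intro v hv
    by_cases hvC : v ∈ C
    · rw [hxC v hvC]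
      rcases h v hvC with ⟨a, ha, b, hb, hab, ga, gb⟩ | ⟨a, ha, b, hb, c, hc, hbc, ga, gb, gc⟩ |
        ⟨a, ha, b, hb, c, hc, d, hd, hab, hac, had, hbc, hbd, hcd, ga, gb, gc, gd⟩
      · refine le_trans (le_of_eq ?_) (hG.sum_le_mulVec hx0 {a, b} (by simp [ga, gb]))
        rw [Finset.sum_pair hab, hxC a ha, hxC b hb]; norm_num
      · have hab : a ≠ b := fun e => hLC b hb (e ▸ ha)
        have hac : a ≠ c := fun e => hLC c hc (e ▸ ha)
        refine le_trans (le_of_eq ?_) (hG.sum_le_mulVec hx0 {a, b, c} (by simp [ga, gb, gc]))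
        rw [Finset.sum_insert (by simp [hab, hac]), Finset.sum_pair hbc, hxC a ha, hxL b hb,
          hxL c hc]
        norm_num
      · refine le_trans (le_of_eq ?_)
          (hG.sum_le_mulVec hx0 {a, b, c, d} (by simp [ga, gb, gc, gd]))
        rw [Finset.sum_insert (by simp [hab, hac, had]), Finset.sum_insert (by simp [hbc, hbd]),
          Finset.sum_pair hcd, hxL a ha, hxL b hb, hxL c hc, hxL d hd]
        norm_num
    · have hvL : v ∈ L := by
        by_contra hvL
        simp [hx, hvC, hvL] at hv
      obtain ⟨a, ha, ga⟩ := hL v hvL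
      rw [hxL v hvL]
      refine le_trans (le_of_eq ?_) (hG.sum_le_mulVec hx0 {a} (by simp [ga]))
      rw [Finset.sum_singleton, hxC a ha]; norm_num

/-- Exclusion of a fixed finite subgraph with adjacency matrix `H` and a positive vector `z`
with `2 z ≤ H z`. -/
lemma not_subgraph {N : ℕ} [NeZero N] (c : Fin N → V) (hc : Function.Injective c)
    (H : Fin N → Fin N → Prop) [∀ a b, Decidable (H a b)] (hH : ∀ a b, H a b → G (c a) (c b) ≠ 0)
    (z : Fin N → ℕ) (hz : ∀ a, 0 < z a) (h : ∀ a, 2 * z a ≤ ∑ b, if H a b then z b else 0) :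
    False := by
  classical
  set x : V → ℝ := Function.extend c (fun a => (z a : ℝ)) 0 with hx
  have hxc : ∀ a, x (c a) = z a := fun a => hc.extend_apply _ _ a
  have hxn : ∀ v, (¬ ∃ a, c a = v) → x v = 0 := fun v hv => Function.extend_apply' _ _ _ hv
  have hx0 : 0 ≤ x := by
    intro v
    by_cases hv : ∃ a, c a = v
    · obtain ⟨a, rfl⟩ := hv
      rw [hxc]; exact Nat.cast_nonneg _
    · rw [hxn v hv]; rfl
  refine hG.not_superharmonic x hx0 ?_ ?_
  · intro h0
    have := congrFun h0 (c 0)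
    rw [hxc, Pi.zero_apply] at this
    exact (hz 0).ne' (by exact_mod_cast this)
  · intro v hv
    obtain ⟨a, rfl⟩ : ∃ a, c a = v := by
      by_contra hv'
      exact hv (hxn v hv')
    refine le_trans ?_
      (hG.sum_le_mulVec hx0 ((Finset.univ.filter (H a)).map ⟨c, hc⟩) ?_)
    · rw [Finset.sum_map, Finset.sum_filter]
      simp only [Function.Embedding.coeFn_mk, hxc]
      exact_mod_cast h a
    · simp only [Finset.mem_map, Finset.mem_filter, Finset.mem_univ, true_and]
      rintro _ ⟨b, hb, rfl⟩
      exact hH a b hb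

end IsDynkin

/-- The vertices `v 0, …, v m` form a path in the graph with adjacency matrix `G`. -/
structure IsPathIn (G : Matrix V V ℝ) (v : ℕ → V) (m : ℕ) : Prop where
  inj : ∀ i j, i ≤ m → j ≤ m → v i = v j → i = j
  adj : ∀ i, i < m → G (v i) (v (i + 1)) ≠ 0

omit [Fintype V] in
lemma IsPathIn.reverse {G : Matrix V V ℝ} (hsymm : ∀ a b, G a b = G b a) {v : ℕ → V} {m : ℕ}
    (hv : IsPathIn G v m) : IsPathIn G (fun i => v (m - i)) m where
  inj i j hi hj h := by
    have := hv.inj _ _ (Nat.sub_le m i) (Nat.sub_le m j) h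
    omega
  adj i hi := by
    have := hv.adj (m - (i + 1)) (by omega)
    rwa [hsymm, show m - (i + 1) + 1 = m - i by omega] at this

/-- `v 0, …, v m` is a path of maximal length. -/
structure IsLongestPath (G : Matrix V V ℝ) (v : ℕ → V) (m : ℕ) : Prop extends IsPathIn G v m where
  max : ∀ w, ¬ IsPathIn G w (m + 1)

lemma exists_isLongestPath [Nonempty V] (G : Matrix V V ℝ) : ∃ v m, IsLongestPath G v m := by
  by_contra! hcon
  have h : ∀ m, ∃ v, IsPathIn G v m := by
    intro m
    induction m with
    | zero => exact ⟨fun _ => Classical.arbitrary V, fun i j hi hj _ => by omega,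
        fun i hi => by omega⟩
    | succ m ih =>
      obtain ⟨v, hv⟩ := ih
      by_contra! hmax
      exact hcon v m ⟨hv, hmax⟩
  obtain ⟨v, hv⟩ := h (Fintype.card V)
  have := Fintype.card_le_of_injective (fun i : Fin (Fintype.card V + 1) => v i) fun i j hij =>
    Fin.ext (hv.inj _ _ (by omega) (by omega) hij)
  simp at this

namespace IsLongestPath

variable {G : Matrix V V ℝ} (hG : IsDynkin G) {v : ℕ → V} {m : ℕ} (hv : IsLongestPath G v m)
include hG hv

lemma reverse : IsLongestPath G (fun i => v (m - i)) m :=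
  ⟨hv.toIsPathIn.reverse hG.symm, hv.max⟩

lemma adj_pred {i : ℕ} (h0 : 0 < i) (hi : i ≤ m) : G (v i) (v (i - 1)) ≠ 0 := by
  have := hv.adj (i - 1) (by omega)
  rw [Nat.sub_add_cancel h0] at this
  exact hG.symm_ne this

lemma eq_succ_of_adj {i j : ℕ} (hij : i < j) (hj : j ≤ m) (h : G (v i) (v j) ≠ 0) :
    j = i + 1 := by
  by_contra hne
  have hd : ∀ a b, a ≤ m → b ≤ m → a ≠ b → v a ≠ v b := fun a b ha hb hab e =>
    hab (hv.inj a b ha hb e)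
  refine hG.not_cycle (v '' Set.Icc i j) ⟨v i, i, ⟨le_rfl, hij.le⟩, rfl⟩ ?_
  rintro _ ⟨a, ⟨hia, haj⟩, rfl⟩
  rcases hia.eq_or_lt with rfl | hia
  · exact ⟨v (i + 1), ⟨_, ⟨by omega, by omega⟩, rfl⟩, v j, ⟨_, ⟨by omega, le_rfl⟩, rfl⟩,
      hd _ _ (by omega) hj (by omega), hv.adj _ (by omega), h⟩
  · rcases haj.eq_or_lt with rfl | haj
    · exact ⟨v (a - 1), ⟨_, ⟨by omega, by omega⟩, rfl⟩, v i, ⟨_, ⟨le_rfl, by omega⟩, rfl⟩,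
        hd _ _ (by omega) (by omega) (by omega), hv.adj_pred hG (by omega) hj, hG.symm_ne h⟩
    · exact ⟨v (a - 1), ⟨_, ⟨by omega, by omega⟩, rfl⟩, v (a + 1), ⟨_, ⟨by omega, by omega⟩, rfl⟩,
        hd _ _ (by omega) (by omega) (by omega), hv.adj_pred hG (by omega) (by omega),
        hv.adj _ (by omega)⟩

lemma pos_of_adj {w : V} (hw : ∀ j ≤ m, v j ≠ w) {i : ℕ} (h : G (v i) w ≠ 0) : 0 < i := by
  by_contra h0
  obtain rfl : i = 0 := by omega
  refine hv.max (fun k => if k = 0 then w else v (k - 1)) ⟨?_, ?_⟩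
  · intro i j hi hj hij
    split_ifs at hij with h1 h2 h2
    · omega
    · exact absurd hij.symm (hw _ (by omega))
    · exact absurd hij (hw _ (by omega))
    · have := hv.inj _ _ (by omega) (by omega) hij
      omega
  · intro i hi
    rcases Nat.eq_zero_or_pos i with rfl | hpos
    · simpa using hG.symm_ne h
    · have := hv.adj (i - 1) (by omega)
      rw [if_neg (by omega), if_neg (by omega), Nat.add_sub_cancel]
      rwa [Nat.sub_add_cancel hpos] at this

lemma lt_of_adj {w : V} (hw : ∀ j ≤ m, v j ≠ w) {i : ℕ} (hi : i ≤ m) (h : G (v i) w ≠ 0) :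
    i < m := by
  have := (hv.reverse hG).pos_of_adj hG (w := w) (i := m - i) (fun j _ => hw _ (Nat.sub_le _ _))
    (by rwa [Nat.sub_sub_self hi])
  omega

/-- A vertex off a longest path has at most one neighbour on it. -/
lemma eq_of_adj_of_adj {w : V} (hw : ∀ j ≤ m, v j ≠ w) {i j : ℕ} (hij : i < j) (hj : j ≤ m)
    (hi : G (v i) w ≠ 0) (hjw : G (v j) w ≠ 0) : False := by
  have hd : ∀ a b, a ≤ m → b ≤ m → a ≠ b → v a ≠ v b := fun a b ha hb hab e =>
    hab (hv.inj a b ha hb e)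
  have hmem : ∀ a, i ≤ a → a ≤ j → v a ∈ insert w (v '' Set.Icc i j) := fun a h1 h2 =>
    Or.inr ⟨a, ⟨h1, h2⟩, rfl⟩
  have hwm : w ∈ insert w (v '' Set.Icc i j) := Or.inl rfl
  refine hG.not_cycle (insert w (v '' Set.Icc i j)) ⟨w, hwm⟩ ?_
  rintro _ (rfl | ⟨a, ⟨hia, haj⟩, rfl⟩)
  · exact ⟨v i, hmem _ le_rfl hij.le, v j, hmem _ hij.le le_rfl,
      hd _ _ (by omega) hj (by omega), hG.symm_ne hi, hG.symm_ne hjw⟩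
  rcases hia.eq_or_lt with rfl | hia
  · exact ⟨v (i + 1), hmem _ (by omega) (by omega), w, hwm, hw _ (by omega),
      hv.adj _ (by omega), hi⟩
  · rcases haj.eq_or_lt with rfl | haj
    · exact ⟨v (a - 1), hmem _ (by omega) (by omega), w, hwm, hw _ (by omega),
        hv.adj_pred hG (by omega) hj, hjw⟩
    · exact ⟨v (a - 1), hmem _ (by omega) (by omega), v (a + 1), hmem _ (by omega) (by omega),
        hd _ _ (by omega) (by omega) (by omega), hv.adj_pred hG (by omega) (by omega),
        hv.adj _ (by omega)⟩

/-- At most one vertex off a longest path has a neighbour on it. -/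
lemma eq_of_le_of_adj {w w' : V} (hw : ∀ j ≤ m, v j ≠ w) (hw' : ∀ j ≤ m, v j ≠ w') {i j : ℕ}
    (hij : i ≤ j) (hj : j ≤ m) (hi : G (v i) w ≠ 0) (hjw : G (v j) w' ≠ 0) : w = w' := by
  by_contra hne
  have hd : ∀ a b, a ≤ m → b ≤ m → a ≠ b → v a ≠ v b := fun a b ha hb hab e =>
    hab (hv.inj a b ha hb e)
  have hi0 := hv.pos_of_adj hG hw hi
  have hjm := hv.lt_of_adj hG hw' hj hjw
  have hC : ∀ a, i ≤ a → a ≤ j → v a ∈ v '' Set.Icc i j := fun a h1 h2 => ⟨a, ⟨h1, h2⟩, rfl⟩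
  refine hG.not_extended_D (v '' Set.Icc i j) {w, w', v (i - 1), v (j + 1)}
    ⟨v i, hC i le_rfl hij⟩ ?_ ?_ ?_
  · rw [Set.disjoint_left]
    rintro _ ⟨a, ⟨hia, haj⟩, rfl⟩ (h | h | h | h)
    · exact hw a (by omega) h
    · exact hw' a (by omega) h
    · exact hd _ _ (by omega) (by omega) (by omega) h
    · exact hd _ _ (by omega) (by omega) (by omega) h
  · rintro _ (rfl | rfl | rfl | rfl)
    · exact ⟨_, hC i le_rfl hij, hG.symm_ne hi⟩
    · exact ⟨_, hC j hij le_rfl, hG.symm_ne hjw⟩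
    · exact ⟨_, hC i le_rfl hij, hG.symm_ne (hv.adj_pred hG hi0 (by omega))⟩
    · exact ⟨_, hC j hij le_rfl, hG.symm_ne (hv.adj _ hjm)⟩
  · rintro _ ⟨a, ⟨hia, haj⟩, rfl⟩
    rcases hia.eq_or_lt with rfl | hia
    · rcases hij.eq_or_lt with rfl | hij
      · refine Or.inr (Or.inr ⟨w, by simp, w', by simp, v (i - 1), by simp, v (i + 1), by simp,
          hne, (hw _ (by omega)).symm, (hw _ (by omega)).symm, (hw' _ (by omega)).symm,
          (hw' _ (by omega)).symm, hd _ _ (by omega) (by omega) (by omega), hi, hjw,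
          hv.adj_pred hG hi0 hj, hv.adj _ hjm⟩)
      · exact Or.inr (Or.inl ⟨v (i + 1), hC _ (by omega) (by omega), w, by simp, v (i - 1),
          by simp, (hw _ (by omega)).symm, hv.adj _ (by omega), hi,
          hv.adj_pred hG hi0 (by omega)⟩)
    · rcases haj.eq_or_lt with rfl | haj
      · exact Or.inr (Or.inl ⟨v (a - 1), hC _ (by omega) (by omega), w', by simp, v (a + 1),
          by simp, (hw' _ (by omega)).symm, hv.adj_pred hG (by omega) (by omega), hjw,
          hv.adj _ hjm⟩)
      · exact Or.inl ⟨v (a - 1), hC _ (by omega) (by omega), v (a + 1), hC _ (by omega) (by omega),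
          hd _ _ (by omega) (by omega) (by omega), hv.adj_pred hG (by omega) (by omega),
          hv.adj _ (by omega)⟩

lemma eq_of_adj {w w' : V} (hw : ∀ j ≤ m, v j ≠ w) (hw' : ∀ j ≤ m, v j ≠ w') {i j : ℕ}
    (hi : i ≤ m) (hj : j ≤ m) (hiw : G (v i) w ≠ 0) (hjw : G (v j) w' ≠ 0) : w = w' := by
  rcases le_total i j with h | h
  · exact hv.eq_of_le_of_adj hG hw hw' h hj hiw hjw
  · exact (hv.eq_of_le_of_adj hG hw' hw h hi hjw hiw).symm

omit [Fintype V] hG in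
lemma injective_extend {w : V} (hw : ∀ j ≤ m, v j ≠ w) {s M : ℕ} (hs : s + M ≤ m) :
    Function.Injective fun a : Fin (M + 2) => if (a : ℕ) ≤ M then v (s + a) else w := by
  intro a b hab
  have ha := a.2
  have hb := b.2
  dsimp only at hab
  split_ifs at hab with h1 h2 h2
  · have := hv.inj _ _ (by omega) (by omega) hab
    omega
  · exact absurd hab (hw _ (by omega))
  · exact absurd hab.symm (hw _ (by omega))
  · omega

lemma adj_extend {w : V} {i s M : ℕ} (hs : s + M ≤ m) (hi : i ≤ M) (hiw : G (v (s + i)) w ≠ 0)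
    {a b : ℕ} (h : BranchAdj M i a b) :
    G (if a ≤ M then v (s + a) else w) (if b ≤ M then v (s + b) else w) ≠ 0 := by
  rcases h with ⟨rfl, h⟩ | ⟨rfl, h⟩ | ⟨rfl, rfl⟩ | ⟨rfl, rfl⟩
  · rw [if_pos h, if_pos (by omega)]
    exact hv.adj (s + a) (by omega)
  · rw [if_pos h, if_pos (by omega)]
    exact hG.symm_ne (hv.adj (s + b) (by omega))
  · rw [if_pos hi, if_neg (by omega)]
    exact hiw
  · rw [if_pos hi, if_neg (by omega)]
    exact hG.symm_ne hiw

lemma not_branch {w : V} (hw : ∀ j ≤ m, v j ≠ w) {i s M : ℕ} (hs : s + M ≤ m) (hi : i ≤ M)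
    (hiw : G (v (s + i)) w ≠ 0) (z : Fin (M + 2) → ℕ) (hz : ∀ a, 0 < z a)
    (h : ∀ a : Fin (M + 2), 2 * z a ≤ ∑ b : Fin (M + 2), if BranchAdj M i a b then z b else 0) :
    False :=
  hG.not_subgraph _ (hv.injective_extend hw hs) (fun a b => BranchAdj M i a b)
    (fun _ _ hab => hv.adj_extend hG hs hi hiw hab) z hz h

lemma two_le_of_adj {w w' : V} (hw : ∀ j ≤ m, v j ≠ w) (hw' : ∀ j ≤ m, v j ≠ w')
    {i : ℕ} (hiw : G (v i) w ≠ 0) (hww' : G w w' ≠ 0) : 2 ≤ i := by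
  have hi0 := hv.pos_of_adj hG hw hiw
  have hne := hG.ne_of_ne_zero hww'
  by_contra h0
  obtain rfl : i = 1 := by omega
  refine hv.max (fun k => if k = 0 then w' else if k = 1 then w else v (k - 1)) ⟨?_, ?_⟩
  · intro i j hi hj hij
    split_ifs at hij with h1 h2 h3 h4 h5 h6 h7 h8
    · omega
    · exact absurd hij.symm hne
    · exact absurd hij.symm (hw' _ (by omega))
    · exact absurd hij hne
    · omega
    · exact absurd hij.symm (hw _ (by omega))
    · exact absurd hij (hw' _ (by omega))
    · exact absurd hij (hw _ (by omega))
    · have := hv.inj _ _ (by omega) (by omega) hij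
      omega
  · intro i hi
    rcases Nat.lt_or_ge i 2 with hi2 | hi2
    · interval_cases i
      · simpa using hG.symm_ne hww'
      · simpa using hG.symm_ne hiw
    · have := hv.adj (i - 1) (by omega)
      rw [if_neg (by omega), if_neg (by omega), if_neg (by omega), if_neg (by omega),
        Nat.add_sub_cancel]
      rwa [Nat.sub_add_cancel (by omega)] at this

/-- The neighbours of a vertex attached to a longest path lie on the path. -/
lemma mem_path_of_adj {w w' : V} (hw : ∀ j ≤ m, v j ≠ w) {i : ℕ} (hi : i ≤ m)
    (hiw : G (v i) w ≠ 0) (hww' : G w w' ≠ 0) : ∃ j ≤ m, v j = w' := by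
  by_contra! hw'
  have hi2 := hv.two_le_of_adj hG hw hw' hiw hww'
  have him := (hv.reverse hG).two_le_of_adj hG (w := w) (w' := w') (i := m - i)
    (fun j _ => hw _ (Nat.sub_le _ _)) (fun j _ => hw' _ (Nat.sub_le _ _))
    (by rwa [Nat.sub_sub_self hi]) hww'
  obtain ⟨s, rfl⟩ : ∃ s, i = s + 2 := ⟨i - 2, by omega⟩
  have hinj := hv.injective_extend hw (s := s) (M := 4) (by omega)
  refine hG.not_subgraph (Fin.snoc (fun a : Fin 6 => if (a : ℕ) ≤ 4 then v (s + a) else w) w')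
    (Fin.snoc_injective_iff.2 ⟨hinj, ?_⟩)
    (fun a b : Fin 7 => (a ≠ 6 ∧ b ≠ 6 ∧ BranchAdj 4 2 a b) ∨ (a = 5 ∧ b = 6) ∨ (a = 6 ∧ b = 5))
    ?_ ![1, 2, 3, 2, 1, 2, 1] (by decide) (by decide)
  · rintro ⟨a, ha⟩
    have := a.2
    dsimp only at ha
    split_ifs at ha with h
    · exact hw' _ (by omega) ha
    · exact hG.ne_of_ne_zero hww' ha
  · rintro a b (⟨ha, hb, h⟩ | ⟨rfl, rfl⟩ | ⟨rfl, rfl⟩)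
    · obtain ⟨a, rfl⟩ := Fin.exists_castSucc_eq.2 (show a ≠ Fin.last 6 from ha)
      obtain ⟨b, rfl⟩ := Fin.exists_castSucc_eq.2 (show b ≠ Fin.last 6 from hb)
      rw [Fin.snoc_castSucc, Fin.snoc_castSucc]
      exact hv.adj_extend hG (by omega) (by norm_num) hiw h
    · exact hww'
    · exact hG.symm_ne hww'

lemma submatrix_eq_pathMatrix (hsurj : ∀ u, ∃ j ≤ m, v j = u) :
    ∃ e : Fin (m + 1) ≃ V, G.submatrix e e = pathMatrix (m + 1) := by
  have hbij : Function.Bijective fun a : Fin (m + 1) => v a := by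
    refine ⟨fun a b hab => Fin.ext (hv.inj _ _ (by omega) (by omega) hab), fun u => ?_⟩
    obtain ⟨j, hj, rfl⟩ := hsurj u
    exact ⟨⟨j, by omega⟩, rfl⟩
  refine ⟨Equiv.ofBijective _ hbij, ?_⟩
  ext a b
  simp only [Matrix.submatrix_apply, Equiv.ofBijective_apply, pathMatrix, Matrix.of_apply]
  have ha := a.2
  have hb := b.2
  split_ifs with h
  · apply hG.eq_one
    rcases h with h | h
    · rw [← h]; exact hv.adj _ (by omega)
    · rw [← h]; exact hG.symm_ne (hv.adj _ (by omega))
  · by_contra h0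
    rcases lt_trichotomy (a : ℕ) b with hab | hab | hab
    · have := hv.eq_succ_of_adj hG hab (by omega) h0; omega
    · rw [hab] at h0; exact h0 (hG.diag _)
    · have := hv.eq_succ_of_adj hG hab (by omega) (hG.symm_ne h0); omega

lemma submatrix_eq_branchMatrix {w : V} (hw : ∀ j ≤ m, v j ≠ w) {i : ℕ} (hi : i ≤ m)
    (hiw : G (v i) w ≠ 0) (hsurj : ∀ u, u = w ∨ ∃ j ≤ m, v j = u) :
    ∃ e : Fin (m + 2) ≃ V, G.submatrix e e = branchMatrix m i := by
  have hbij : Function.Bijective fun a : Fin (m + 2) => if (a : ℕ) ≤ m then v (0 + a) else w := by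
    refine ⟨hv.injective_extend hw (by omega), fun u => ?_⟩
    rcases hsurj u with rfl | ⟨j, hj, rfl⟩
    · exact ⟨⟨m + 1, by omega⟩, by simp⟩
    · exact ⟨⟨j, by omega⟩, by simp [hj]⟩
  have huniq : ∀ j ≤ m, G (v j) w ≠ 0 → j = i := by
    intro j hj hjw
    rcases lt_trichotomy i j with h | h | h
    · exact (hv.eq_of_adj_of_adj hG hw h hj hiw hjw).elim
    · exact h.symm
    · exact (hv.eq_of_adj_of_adj hG hw h hi hjw hiw).elim
  refine ⟨Equiv.ofBijective _ hbij, ?_⟩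
  ext a b
  simp only [Matrix.submatrix_apply, Equiv.ofBijective_apply, branchMatrix, Matrix.of_apply]
  have ha := a.2
  have hb := b.2
  by_cases h : BranchAdj m i a b
  · rw [if_pos h]
    exact hG.eq_one (hv.adj_extend hG (by omega) hi (by rwa [zero_add]) h)
  · rw [if_neg h]
    by_contra h0
    unfold BranchAdj at h
    simp only [zero_add] at h0
    split_ifs at h0 with h1 h2 h2
    · rcases lt_trichotomy (a : ℕ) b with hab | hab | hab
      · have := hv.eq_succ_of_adj hG hab h2 h0; omega
      · rw [hab] at h0; exact h0 (hG.diag _)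
      · have := hv.eq_succ_of_adj hG hab h1 (hG.symm_ne h0); omega
    · have := huniq _ h1 h0; omega
    · have := huniq _ h2 (hG.symm_ne h0); omega
    · exact h0 (hG.diag _)

end IsLongestPath

/-- The classification of simply laced Dynkin diagrams. -/
theorem IsDynkin.classification [Nonempty V] {G : Matrix V V ℝ} (hG : IsDynkin G) :
    (∃ (N : ℕ) (e : Fin N ≃ V), G.submatrix e e = pathMatrix N) ∨
    (∃ (i : ℕ) (e : Fin (i + 1 + 2) ≃ V), 1 ≤ i ∧ G.submatrix e e = branchMatrix (i + 1) i) ∨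
    (∃ (i : ℕ) (e : Fin (i + 2 + 2) ≃ V), (i = 2 ∨ i = 3 ∨ i = 4) ∧
      G.submatrix e e = branchMatrix (i + 2) i) := by
  obtain ⟨v, m, hv⟩ := exists_isLongestPath G
  by_cases hsurj : ∀ u, ∃ j ≤ m, v j = u
  · obtain ⟨e, he⟩ := hv.submatrix_eq_pathMatrix hG hsurj
    exact Or.inl ⟨_, e, he⟩
  right
  obtain ⟨v, hv, w, hw, i, hi, hiw, hmi⟩ : ∃ v, IsLongestPath G v m ∧ ∃ w, (∀ j ≤ m, v j ≠ w) ∧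
      ∃ i ≤ m, G (v i) w ≠ 0 ∧ m - i ≤ i := by
    have : ∃ w, (∀ j ≤ m, v j ≠ w) ∧ ∃ i ≤ m, G (v i) w ≠ 0 := by
      by_contra! hcon
      refine hsurj fun u => ?_
      have := hG.conn {u | ∃ j ≤ m, v j = u} ⟨v 0, 0, Nat.zero_le m, rfl⟩ ?_
      · exact this.ge (Set.mem_univ u)
      · rintro _ ⟨i, hi, rfl⟩ w hiw
        by_contra hw
        exact hiw (hcon w (fun j hj h => hw ⟨j, hj, h⟩) i hi)
    obtain ⟨w, hw, i, hi, hiw⟩ := this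
    rcases le_total (m - i) i with h | h
    · exact ⟨v, hv, w, hw, i, hi, hiw, h⟩
    · exact ⟨_, hv.reverse hG, w, fun j _ => hw _ (Nat.sub_le _ _), m - i, Nat.sub_le _ _,
        by rwa [Nat.sub_sub_self hi], by omega⟩
  have hall : ∀ u, u = w ∨ ∃ j ≤ m, v j = u := by
    intro u
    have := hG.conn {u | u = w ∨ ∃ j ≤ m, v j = u} ⟨w, Or.inl rfl⟩ ?_
    · exact this.ge (Set.mem_univ u)
    · rintro _ (rfl | ⟨j, hj, rfl⟩) u hu
      · exact Or.inr (hv.mem_path_of_adj hG hw hi hiw hu)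
      · by_cases hu' : ∃ j ≤ m, v j = u
        · exact Or.inr hu'
        · push Not at hu'
          exact Or.inl (hv.eq_of_adj hG hu' hw hj hi hu hiw)
  obtain ⟨e, he⟩ := hv.submatrix_eq_branchMatrix hG hw hi hiw hall
  have hi0 := hv.pos_of_adj hG hw hiw
  have him := hv.lt_of_adj hG hw hi hiw
  rcases Nat.lt_or_ge m (i + 2) with h1 | h1
  · obtain rfl : m = i + 1 := by omega
    exact Or.inl ⟨i, e, hi0, he⟩
  rcases Nat.lt_or_ge m (i + 3) with h2 | h2
  · obtain rfl : m = i + 2 := by omega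
    refine Or.inr ⟨i, e, ?_, he⟩
    by_contra hi'
    obtain ⟨s, rfl⟩ : ∃ s, i = s + 5 := ⟨i - 5, by omega⟩
    exact hv.not_branch hG hw (i := 5) (s := s) (M := 7) (by omega) (by norm_num) hiw
      ![1, 2, 3, 4, 5, 6, 4, 2, 3] (by decide) (by decide)
  · obtain ⟨s, rfl⟩ : ∃ s, i = s + 3 := ⟨i - 3, by omega⟩
    exact (hv.not_branch hG hw (i := 3) (s := s) (M := 6) (by omega) (by norm_num) hiw
      ![1, 2, 3, 4, 3, 2, 1, 2] (by decide) (by decide)).elim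

end Classification

section Bipartite

lemma pos_of_mul_chebSeq_eq_zero {V : Type*} [Fintype V] [DecidableEq V] {M : Matrix V V ℝ}
    (hM : Mᵀ = M) {n : ℕ} (hn : 0 < n) (h : M * chebSeq M n = 0) {x : V → ℝ} (hx : x ≠ 0) :
    x ⬝ᵥ M *ᵥ x < 2 * (x ⬝ᵥ x) := by
  have hH : ((2 : ℝ) • (1 : Matrix V V ℝ) - M).IsHermitian := by
    simp [Matrix.IsHermitian, Matrix.conjTranspose_eq_transpose_of_trivial, hM]
  have hpos : ((2 : ℝ) • (1 : Matrix V V ℝ) - M).PosDef := by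
    rw [hH.posDef_iff_eigenvalues_pos]
    intro i
    by_contra! hle
    set w : V → ℝ := (hH.eigenvectorBasis i).ofLp with hw
    have hw0 : w ≠ 0 := by
      intro h0
      exact hH.eigenvectorBasis.orthonormal.ne_zero i (by ext a; exact congrFun h0 a)
    have hMw : M *ᵥ w = (2 - hH.eigenvalues i) • w := by
      have := hH.mulVec_eigenvectorBasis i
      rw [← hw, Matrix.sub_mulVec, Matrix.smul_mulVec, Matrix.one_mulVec] at this
      rw [sub_smul, ← this, sub_sub_cancel]
    set l := 2 - hH.eigenvalues i with hl
    have hl2 : 2 ≤ l := by linarith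
    have key : ∀ j, ∃ c d : ℝ, chebSeq M j *ᵥ w = c • w ∧ chebSeq M (j + 1) *ᵥ w = d • w ∧
        0 ≤ c ∧ c + 1 ≤ d := by
      intro j
      induction j with
      | zero => exact ⟨0, 1, by simp [chebSeq], by simp [chebSeq], le_rfl, by norm_num⟩
      | succ j ih =>
        obtain ⟨c, d, hc, hd, h0, hcd⟩ := ih
        refine ⟨d, l * d - c, hd, ?_, by linarith, by nlinarith⟩
        rw [chebSeq, Matrix.sub_mulVec, ← Matrix.mulVec_mulVec, hc, hd, Matrix.mulVec_smul, hMw,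
          smul_smul, sub_smul, mul_comm]
    obtain ⟨c, d, -, hd, h0, hcd⟩ := key (n - 1)
    rw [Nat.sub_add_cancel hn] at hd
    have := congrArg (· *ᵥ w) h
    simp only [← Matrix.mulVec_mulVec, hd, Matrix.mulVec_smul, hMw, Matrix.zero_mulVec, smul_smul,
      smul_eq_zero, hw0, or_false, mul_eq_zero] at this
    rcases this with h | h <;> linarith
  have := hpos.dotProduct_mulVec_pos hx
  simp only [star_trivial, Matrix.sub_mulVec, Matrix.smul_mulVec, Matrix.one_mulVec,
    dotProduct_sub, dotProduct_smul, smul_eq_mul] at this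
  linarith

variable {p q : ℕ}

/-- The adjacency matrix of the bipartite graph with biadjacency matrix `B`. -/
def bipartiteMatrix (B : Matrix (Fin p) (Fin q) ℝ) : Matrix (Fin p ⊕ Fin q) (Fin p ⊕ Fin q) ℝ :=
  Matrix.fromBlocks 0 B Bᵀ 0

lemma bipartiteMatrix_mul_self (B : Matrix (Fin p) (Fin q) ℝ) :
    bipartiteMatrix B * bipartiteMatrix B = Matrix.fromBlocks (B * Bᵀ) 0 0 (Bᵀ * B) := by
  simp [bipartiteMatrix, Matrix.fromBlocks_multiply]

lemma fpoly_even (j : ℕ) : fpoly (2 * j + 2) = X * fpoly (2 * j + 1) - fpoly (2 * j) := by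
  rw [fpoly, if_neg (by omega)]

lemma fpoly_odd (j : ℕ) : fpoly (2 * j + 3) = fpoly (2 * j + 2) - fpoly (2 * j + 1) := by
  rw [fpoly, if_pos (by omega)]

lemma chebSeq_bipartiteMatrix (B : Matrix (Fin p) (Fin q) ℝ) (j : ℕ) :
    bipartiteMatrix B * chebSeq (bipartiteMatrix B) (2 * j) =
      Matrix.fromBlocks (aeval (B * Bᵀ) (fpoly (2 * j))) 0 0 (aeval (Bᵀ * B) (fpoly (2 * j))) ∧
    chebSeq (bipartiteMatrix B) (2 * j + 1) =
      Matrix.fromBlocks (aeval (B * Bᵀ) (fpoly (2 * j + 1))) 0 0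
        (aeval (Bᵀ * B) (fpoly (2 * j + 1))) := by
  induction j with
  | zero => simp [chebSeq, fpoly]
  | succ j ih =>
    obtain ⟨h0, h1⟩ := ih
    have h2 : bipartiteMatrix B * chebSeq (bipartiteMatrix B) (2 * j + 2) =
        Matrix.fromBlocks (aeval (B * Bᵀ) (fpoly (2 * j + 2))) 0 0
          (aeval (Bᵀ * B) (fpoly (2 * j + 2))) := by
      rw [chebSeq, mul_sub, ← Matrix.mul_assoc, bipartiteMatrix_mul_self, h0, h1,
        Matrix.fromBlocks_multiply, fpoly_even]
      simp [sub_eq_add_neg, Matrix.fromBlocks_neg, Matrix.fromBlocks_add]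
    refine ⟨h2, ?_⟩
    rw [show 2 * (j + 1) + 1 = 2 * j + 3 by ring, chebSeq, h1, h2, fpoly_odd]
    simp [sub_eq_add_neg, Matrix.fromBlocks_neg, Matrix.fromBlocks_add]

lemma aeval_fpoly_of_chebSeq_eq_zero {B : Matrix (Fin p) (Fin q) ℝ} {n : ℕ}
    (h : chebSeq (bipartiteMatrix B) n = 0) :
    aeval (B * Bᵀ) (fpoly n) = 0 ∧ aeval (Bᵀ * B) (fpoly n) = 0 := by
  have key : Matrix.fromBlocks (aeval (B * Bᵀ) (fpoly n)) 0 0 (aeval (Bᵀ * B) (fpoly n)) = 0 := by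
    obtain ⟨j, rfl | rfl⟩ := n.even_or_odd'
    · rw [← (chebSeq_bipartiteMatrix B j).1, h, mul_zero]
    · rw [← (chebSeq_bipartiteMatrix B j).2, h]
  rw [← Matrix.fromBlocks_zero, Matrix.fromBlocks_inj] at key
  exact ⟨key.1, key.2.2.2⟩

lemma mul_chebSeq_eq_zero {B : Matrix (Fin p) (Fin q) ℝ} {k : ℕ}
    (h : aeval (B * Bᵀ) (fpoly (2 * k)) = 0 ∧ aeval (Bᵀ * B) (fpoly (2 * k)) = 0) :
    bipartiteMatrix B * chebSeq (bipartiteMatrix B) (2 * k) = 0 := by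
  rw [(chebSeq_bipartiteMatrix B k).1, h.1, h.2, Matrix.fromBlocks_zero]

end Bipartite

section Irreducible

lemma eq_univ_of_isIrreducibleMat {n : ℕ} {M : Matrix (Fin n) (Fin n) ℝ}
    (hM : IsIrreducibleMat M) {U : Set (Fin n)} (h : ∀ i ∈ U, ∀ j, M i j ≠ 0 → j ∈ U)
    {i : Fin n} (hi : i ∈ U) (j : Fin n) : j ∈ U := by
  obtain ⟨m, -, hm⟩ := hM i j
  have key : ∀ m j, (M ^ m) i j ≠ 0 → j ∈ U := by
    intro m
    induction m with
    | zero =>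
      intro j hj
      rw [pow_zero] at hj
      by_cases hij : i = j
      · exact hij ▸ hi
      · exact absurd (Matrix.one_apply_ne hij) hj
    | succ m ih =>
      intro j hj
      rw [pow_succ, Matrix.mul_apply] at hj
      obtain ⟨l, -, hl⟩ := Finset.exists_ne_zero_of_sum_ne_zero hj
      exact h l (ih l (left_ne_zero_of_mul hl)) j (right_ne_zero_of_mul hl)
  exact key m j hm.ne'

variable {p q : ℕ} {B : Matrix (Fin p) (Fin q) ℝ}

/-- A set of rows closed under sharing a column with nonzero entries contains all rows. -/
lemma forall_mem_of_isIrreducibleMat (h : IsIrreducibleMat (B * Bᵀ)) {U : Set (Fin p)}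
    (hU : ∀ i ∈ U, ∀ l, B i l ≠ 0 → ∀ j, B j l ≠ 0 → j ∈ U) {i : Fin p} (hi : i ∈ U)
    (j : Fin p) : j ∈ U := by
  refine eq_univ_of_isIrreducibleMat h (fun i hi j hij => ?_) hi j
  rw [Matrix.mul_apply] at hij
  obtain ⟨l, -, hl⟩ := Finset.exists_ne_zero_of_sum_ne_zero hij
  exact hU i hi l (left_ne_zero_of_mul hl) j (right_ne_zero_of_mul hl)

lemma bipartite_connected (hB : B ≠ 0) (h1 : IsIrreducibleMat (B * Bᵀ))
    (h2 : IsIrreducibleMat (Bᵀ * B)) (U : Set (Fin p ⊕ Fin q)) (hne : U.Nonempty)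
    (hU : ∀ u ∈ U, ∀ v, bipartiteMatrix B u v ≠ 0 → v ∈ U) : U = Set.univ := by
  have hlr : ∀ i l, B i l ≠ 0 → Sum.inl i ∈ U → Sum.inr l ∈ U := fun i l hil hi =>
    hU _ hi _ (by simpa [bipartiteMatrix] using hil)
  have hrl : ∀ i l, B i l ≠ 0 → Sum.inr l ∈ U → Sum.inl i ∈ U := fun i l hil hi =>
    hU _ hi _ (by simpa [bipartiteMatrix] using hil)
  have hleft : ∀ i, Sum.inl i ∈ U → ∀ j, Sum.inl j ∈ U := fun i hi j =>
    forall_mem_of_isIrreducibleMat (U := {i | Sum.inl i ∈ U}) h1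
      (fun i hi l hl j hj => hrl j l hj (hlr i l hl hi)) hi j
  have hright : ∀ i, Sum.inr i ∈ U → ∀ j, Sum.inr j ∈ U := fun i hi j =>
    forall_mem_of_isIrreducibleMat (B := Bᵀ) (U := {i | Sum.inr i ∈ U}) h2
      (fun i hi l hl j hj => hlr l j hj (hrl l i hl hi)) hi j
  obtain ⟨i, l, hil⟩ : ∃ i l, B i l ≠ 0 := by
    by_contra! hcon
    exact hB (Matrix.ext hcon)
  have hi : Sum.inl i ∈ U := by
    obtain ⟨u | u, hu⟩ := hne
    · exact hleft u hu i
    · exact hrl i l hil (hright u hu l)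
  refine Set.eq_univ_of_forall ?_
  rintro (j | j)
  · exact hleft i hi j
  · exact hright l (hlr i l hil hi) j

lemma isDynkin_bipartiteMatrix (hnat : ∀ i j, ∃ m : ℕ, B i j = (m : ℝ)) (hB : B ≠ 0)
    (h1 : IsIrreducibleMat (B * Bᵀ)) (h2 : IsIrreducibleMat (Bᵀ * B)) {n : ℕ} (hn : 0 < n)
    (h : bipartiteMatrix B * chebSeq (bipartiteMatrix B) n = 0) :
    IsDynkin (bipartiteMatrix B) where
  symm := by rintro (u | u) (v | v) <;> simp [bipartiteMatrix]
  nat := by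
    rintro (u | u) (v | v)
    · exact ⟨0, by simp [bipartiteMatrix]⟩
    · simpa [bipartiteMatrix] using hnat u v
    · simpa [bipartiteMatrix] using hnat v u
    · exact ⟨0, by simp [bipartiteMatrix]⟩
  diag := by rintro (u | u) <;> simp [bipartiteMatrix]
  pos x hx := pos_of_mul_chebSeq_eq_zero
    (by simp [bipartiteMatrix, Matrix.fromBlocks_transpose]) hn h hx
  conn := bipartite_connected hB h1 h2

end Irreducible

section PermEquiv

lemma _root_.PermEquiv.transpose {p q r s : ℕ} {X : Matrix (Fin p) (Fin q) ℝ}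
    {Y : Matrix (Fin r) (Fin s) ℝ} (h : PermEquiv X Y) : PermEquiv Xᵀ Yᵀ := by
  obtain ⟨e, f, h⟩ := h
  exact ⟨f, e, fun i j => h j i⟩

lemma _root_.PermEquiv.size_eq {p q r s : ℕ} {X : Matrix (Fin p) (Fin q) ℝ}
    {Y : Matrix (Fin r) (Fin s) ℝ} (h : PermEquiv X Y) : p = r ∧ q = s := by
  obtain ⟨e, f, -⟩ := h
  exact ⟨by simpa using Fintype.card_congr e, by simpa using Fintype.card_congr f⟩

variable {p q N : ℕ} {B : Matrix (Fin p) (Fin q) ℝ} {e : Fin N ≃ Fin p ⊕ Fin q}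
  {T : Matrix (Fin N) (Fin N) ℝ}

/-- A labelling of the vertices of the bipartite graph of `B` by rows and columns of `Y`
that respects sides and adjacency identifies `B` with `Y`. -/
lemma permEquiv_of_submatrix (he : (bipartiteMatrix B).submatrix e e = T) {p' q' : ℕ}
    {Y : Matrix (Fin p') (Fin q') ℝ} (hN : p' + q' = N) (r : Fin p' → Fin N) (c : Fin q' → Fin N)
    (hr : Function.Injective r) (hc : Function.Injective c)
    (hrl : ∀ a, (e (r a)).isLeft = true) (hcl : ∀ b, (e (c b)).isLeft = false)
    (hY : ∀ a b, T (r a) (c b) = Y a b) : PermEquiv B Y := by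
  choose f hf using fun a => Sum.isLeft_iff.1 (hrl a)
  choose g hg using fun b => Sum.isRight_iff.1 (Sum.isLeft_eq_false.1 (hcl b))
  have hfi : Function.Injective f := fun a b hab =>
    hr (e.injective (by rw [hf, hf, hab]))
  have hgi : Function.Injective g := fun a b hab =>
    hc (e.injective (by rw [hg, hg, hab]))
  have hcard : N = p + q := by simpa using Fintype.card_congr e
  have hp : p' ≤ p := by simpa using Fintype.card_le_of_injective f hfi
  have hq : q' ≤ q := by simpa using Fintype.card_le_of_injective g hgi
  let F := Equiv.ofBijective f
    ((Fintype.bijective_iff_injective_and_card f).2 ⟨hfi, by simp; omega⟩)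
  let H := Equiv.ofBijective g
    ((Fintype.bijective_iff_injective_and_card g).2 ⟨hgi, by simp; omega⟩)
  suffices h : ∀ a b, B (F a) (H b) = Y a b from
    ⟨F.symm, H.symm, fun i j => by rw [← h, F.apply_symm_apply, H.apply_symm_apply]⟩
  intro a b
  rw [← hY, ← he, Matrix.submatrix_apply, hf, hg]
  rfl

lemma isLeft_eq_not (he : (bipartiteMatrix B).submatrix e e = T) {u v : Fin N}
    (h : T u v ≠ 0) : (e v).isLeft = !(e u).isLeft := by
  rw [← he, Matrix.submatrix_apply] at h
  rcases hu : e u with i | i <;> rcases hv : e v with j | j <;>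
    simp [hu, hv, bipartiteMatrix] at h ⊢

/-- Along a path that starts in a column, the rows are the odd vertices. -/
lemma isLeft_eq_decide_odd (he : (bipartiteMatrix B).submatrix e e = T) {m : ℕ} (hm : m < N)
    (hadj : ∀ a (ha : a + 1 ≤ m), T ⟨a, by omega⟩ ⟨a + 1, by omega⟩ ≠ 0)
    (h0 : (e ⟨0, by omega⟩).isLeft = false) (a : ℕ) (ha : a ≤ m) :
    (e ⟨a, by omega⟩).isLeft = decide (a % 2 = 1) := by
  induction a with
  | zero => simpa using h0
  | succ a ih =>
    rw [isLeft_eq_not he (hadj a ha), ih (by omega)]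
    rcases Nat.mod_two_eq_zero_or_one a with h | h <;> simp [h, Nat.add_mod]

lemma bipartiteMatrix_transpose_submatrix (he : (bipartiteMatrix B).submatrix e e = T) :
    (bipartiteMatrix Bᵀ).submatrix (e.trans (Equiv.sumComm _ _)) (e.trans (Equiv.sumComm _ _)) =
      T := by
  rw [← he]
  ext u v
  rcases hu : e u with i | i <;> rcases hv : e v with j | j <;>
    simp [hu, hv, bipartiteMatrix]

lemma isLeft_sumComm {α β : Type*} (x : α ⊕ β) :
    (Equiv.sumComm α β x).isLeft = !x.isLeft := by
  cases x <;> rfl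

lemma permEquiv_stairRect {l : ℕ} {e : Fin (2 * l + 1) ≃ Fin p ⊕ Fin q}
    (he : (bipartiteMatrix B).submatrix e e = pathMatrix (2 * l + 1))
    (h0 : (e 0).isLeft = false) : PermEquiv B (stairRect l) := by
  have hside := isLeft_eq_decide_odd he (m := 2 * l) (by omega)
    (fun a ha => by simp [pathMatrix]) h0
  refine permEquiv_of_submatrix he (by ring) (fun a => ⟨2 * a + 1, by omega⟩)
    (fun b => ⟨2 * b, by omega⟩) (fun a b hab => ?_) (fun a b hab => ?_) (fun a => ?_)
    (fun b => ?_) (fun a b => ?_)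
  · simp only [Fin.mk.injEq] at hab; omega
  · simp only [Fin.mk.injEq] at hab; omega
  · rw [hside _ (by omega), decide_eq_true_iff]; omega
  · rw [hside _ (by omega), decide_eq_false_iff_not]; omega
  · simp only [pathMatrix, stairRect, Matrix.of_apply]
    split_ifs <;> first | rfl | omega

lemma permEquiv_stairRect_or {l : ℕ} {e : Fin (2 * l + 1) ≃ Fin p ⊕ Fin q}
    (he : (bipartiteMatrix B).submatrix e e = pathMatrix (2 * l + 1)) :
    PermEquiv B (stairRect l) ∨ PermEquiv B (stairRect l)ᵀ := by
  cases h0 : (e 0).isLeft with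
  | false => exact .inl (permEquiv_stairRect he h0)
  | true =>
    refine .inr (permEquiv_stairRect (bipartiteMatrix_transpose_submatrix he) ?_).transpose
    rw [Equiv.trans_apply, isLeft_sumComm, h0, Bool.not_true]

lemma isLeft_branch {m i : ℕ} (hi : i ≤ m) {e : Fin (m + 2) ≃ Fin p ⊕ Fin q}
    (he : (bipartiteMatrix B).submatrix e e = branchMatrix m i) (h0 : (e 0).isLeft = false) :
    (∀ a (_ : a ≤ m), (e ⟨a, by omega⟩).isLeft = decide (a % 2 = 1)) ∧
      (e ⟨m + 1, by omega⟩).isLeft = decide (i % 2 = 0) := by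
  have hside := isLeft_eq_decide_odd he (m := m) (by omega)
    (fun a ha => by simp [branchMatrix, BranchAdj, ha]) h0
  refine ⟨hside, ?_⟩
  rw [isLeft_eq_not he (u := ⟨i, by omega⟩) (by simp [branchMatrix, BranchAdj]), hside i hi]
  rcases Nat.mod_two_eq_zero_or_one i with h | h <;> simp [h]

lemma permEquiv_extA {s : ℕ} {e : Fin (2 * s + 1 + 2) ≃ Fin p ⊕ Fin q}
    (he : (bipartiteMatrix B).submatrix e e = branchMatrix (2 * s + 1) (2 * s))
    (h0 : (e 0).isLeft = false) : PermEquiv B (extA (s + 1)) := by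
  obtain ⟨hside, htip⟩ := isLeft_branch (by omega) he h0
  refine permEquiv_of_submatrix he (by ring)
    (fun a => if h : (a : ℕ) ≤ s then ⟨2 * a + 1, by omega⟩ else ⟨2 * s + 1 + 1, by omega⟩)
    (fun b => ⟨2 * b, by omega⟩) (fun a b hab => ?_) (fun a b hab => ?_) (fun a => ?_)
    (fun b => ?_) (fun a b => ?_)
  · simp only at hab
    split_ifs at hab <;> simp only [Fin.mk.injEq] at hab <;> omega
  · simp only [Fin.mk.injEq] at hab; omega
  · split_ifs
    · rw [hside _ (by omega), decide_eq_true_iff]; omega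
    · rw [htip, decide_eq_true_iff]; omega
  · rw [hside _ (by omega), decide_eq_false_iff_not]; omega
  · simp only [branchMatrix, BranchAdj, extA, Matrix.of_apply]
    by_cases h : (a : ℕ) ≤ s
    · simp only [dif_pos h]
      split_ifs <;> first | rfl | omega
    · simp only [dif_neg h, and_true]
      split_ifs <;> first | rfl | omega

lemma permEquiv_extB {s : ℕ} {e : Fin (2 * s + 2 + 2) ≃ Fin p ⊕ Fin q}
    (he : (bipartiteMatrix B).submatrix e e = branchMatrix (2 * s + 2) (2 * s + 1))
    (h0 : (e 0).isLeft = false) : PermEquiv B (extB (s + 1)) := by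
  obtain ⟨hside, htip⟩ := isLeft_branch (by omega) he h0
  refine permEquiv_of_submatrix he (by ring) (fun a => ⟨2 * a + 1, by omega⟩)
    (fun b => if h : (b : ℕ) ≤ s + 1 then ⟨2 * b, by omega⟩ else ⟨2 * s + 2 + 1, by omega⟩)
    (fun a b hab => ?_) (fun a b hab => ?_) (fun a => ?_) (fun b => ?_) (fun a b => ?_)
  · simp only [Fin.mk.injEq] at hab; omega
  · simp only at hab
    split_ifs at hab <;> simp only [Fin.mk.injEq] at hab <;> omega
  · rw [hside _ (by omega), decide_eq_true_iff]; omega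
  · split_ifs
    · rw [hside _ (by omega), decide_eq_false_iff_not]; omega
    · rw [htip, decide_eq_false_iff_not]; omega
  · simp only [branchMatrix, BranchAdj, extB, Matrix.of_apply]
    by_cases h : (b : ℕ) ≤ s + 1
    · simp only [dif_pos h]
      split_ifs <;> first | rfl | omega
    · simp only [dif_neg h, and_true]
      split_ifs <;> first | rfl | omega

lemma permEquiv_extA_or {s : ℕ} {e : Fin (2 * s + 1 + 2) ≃ Fin p ⊕ Fin q}
    (he : (bipartiteMatrix B).submatrix e e = branchMatrix (2 * s + 1) (2 * s)) :
    PermEquiv B (extA (s + 1)) ∨ PermEquiv B (extA (s + 1))ᵀ := by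
  cases h0 : (e 0).isLeft with
  | false => exact .inl (permEquiv_extA he h0)
  | true =>
    refine .inr (permEquiv_extA (bipartiteMatrix_transpose_submatrix he) ?_).transpose
    rw [Equiv.trans_apply, isLeft_sumComm, h0, Bool.not_true]

lemma permEquiv_extB_or {s : ℕ} {e : Fin (2 * s + 2 + 2) ≃ Fin p ⊕ Fin q}
    (he : (bipartiteMatrix B).submatrix e e = branchMatrix (2 * s + 2) (2 * s + 1)) :
    PermEquiv B (extB (s + 1)) ∨ PermEquiv B (extB (s + 1))ᵀ := by
  cases h0 : (e 0).isLeft with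
  | false => exact .inl (permEquiv_extB he h0)
  | true =>
    refine .inr (permEquiv_extB (bipartiteMatrix_transpose_submatrix he) ?_).transpose
    rw [Equiv.trans_apply, isLeft_sumComm, h0, Bool.not_true]

end PermEquiv

end BipartiteDynkin

/-- let `B` be a nonzero matrix with nonnegative integer entries with
`B·Bᵀ` and `Bᵀ·B` irreducible, and let `n` be the smallest positive integer with
`fₙ(B·Bᵀ) = 0` and `fₙ(Bᵀ·B) = 0`. If `n = 2k` is even, `n > 4`, `n ∉ {12,18,30}`,
then, up to independent permutations of rows and columns and possibly transposition,
`B` is the `k×(k−1)` staircase matrix, or an extended staircase matrix of size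
`(k/2)×((k+2)/2)` (for `k` even) or of size `((k+3)/2)×((k−1)/2)` (for `k` odd). -/
theorem statement13 {p q : ℕ} (B : Matrix (Fin p) (Fin q) ℝ)
    (hnat : ∀ i j, ∃ m : ℕ, B i j = (m : ℝ)) (hB : B ≠ 0)
    (h1 : IsIrreducibleMat (B * Bᵀ)) (h2 : IsIrreducibleMat (Bᵀ * B))
    (n : ℕ) (hn : 0 < n)
    (hann : aeval (B * Bᵀ) (fpoly n) = 0 ∧ aeval (Bᵀ * B) (fpoly n) = 0)
    (hmin : ∀ m : ℕ, 0 < m →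
      (aeval (B * Bᵀ) (fpoly m) = 0 ∧ aeval (Bᵀ * B) (fpoly m) = 0) → n ≤ m)
    (k : ℕ) (hk : n = 2 * k) (h4 : 4 < n)
    (h12 : n ≠ 12) (h18 : n ≠ 18) (h30 : n ≠ 30) :
    (PermEquiv B (stairRect (k - 1))ᵀ ∨ PermEquiv Bᵀ (stairRect (k - 1))ᵀ) ∨
    (k % 2 = 0 ∧ IsExtStaircase B ∧
      ((p = k / 2 ∧ q = (k + 2) / 2) ∨ (p = (k + 2) / 2 ∧ q = k / 2))) ∨
    (k % 2 = 1 ∧ IsExtStaircase B ∧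
      ((p = (k + 3) / 2 ∧ q = (k - 1) / 2) ∨ (p = (k - 1) / 2 ∧ q = (k + 3) / 2))) := by
  classical
  subst hk
  have hG := BipartiteDynkin.isDynkin_bipartiteMatrix hnat hB h1 h2 hn
    (BipartiteDynkin.mul_chebSeq_eq_zero hann)
  obtain ⟨i₀, j₀, hij⟩ : ∃ i j, B i j ≠ 0 := by
    by_contra! hcon
    exact hB (Matrix.ext hcon)
  have : Nonempty (Fin p ⊕ Fin q) := ⟨.inl i₀⟩
  have hcox : ∀ h, 0 < h → BipartiteDynkin.IsCoxeterNumber (BipartiteDynkin.bipartiteMatrix B) h →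
      2 * k = h := by
    intro h h0 hh
    refine le_antisymm (hmin h h0 (BipartiteDynkin.aeval_fpoly_of_chebSeq_eq_zero hh.1)) ?_
    by_contra! hlt
    exact hh.2 _ hn hlt (BipartiteDynkin.mul_chebSeq_eq_zero hann)
  rcases hG.classification with ⟨N, e, he⟩ | ⟨i, e, hi, he⟩ | ⟨i, e, rfl | rfl | rfl, he⟩
  · have hN : 2 ≤ N := by
      have hcard : N = p + q := by simpa using Fintype.card_congr e
      have := i₀.pos
      have := j₀.pos
      omega
    have hk := hcox (N + 1) (by omega)
      (.of_submatrix (he ▸ BipartiteDynkin.isCoxeterNumber_pathMatrix hN))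
    obtain ⟨l, rfl⟩ : ∃ l, k = l + 1 := ⟨k - 1, by omega⟩
    obtain rfl : N = 2 * l + 1 := by omega
    left
    exact (BipartiteDynkin.permEquiv_stairRect_or he).symm.imp id PermEquiv.transpose
  · have hk := hcox (2 * (i + 2)) (by omega)
      (.of_submatrix (he ▸ BipartiteDynkin.isCoxeterNumber_branchMatrix_one i))
    right
    obtain ⟨s, rfl | rfl⟩ := i.even_or_odd'
    · left
      rcases BipartiteDynkin.permEquiv_extA_or he with h | h
      · have := h.size_eq
        exact ⟨by omega, ⟨s + 1, by omega, .inl h⟩, by omega⟩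
      · have := h.size_eq
        exact ⟨by omega, ⟨s + 1, by omega, .inr (.inl h)⟩, by omega⟩
    · right
      rcases BipartiteDynkin.permEquiv_extB_or he with h | h
      · have := h.size_eq
        exact ⟨by omega, ⟨s + 1, by omega, .inr (.inr (.inl h))⟩, by omega⟩
      · have := h.size_eq
        exact ⟨by omega, ⟨s + 1, by omega, .inr (.inr (.inr h))⟩, by omega⟩
  · exact absurd (hcox 12 (by norm_num)
      (.of_submatrix (he ▸ BipartiteDynkin.isCoxeterNumber_E_six))) h12
  · exact absurd (hcox 18 (by norm_num)
      (.of_submatrix (he ▸ BipartiteDynkin.isCoxeterNumber_E_seven))) h18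
  · exact absurd (hcox 30 (by norm_num)
      (.of_submatrix (he ▸ BipartiteDynkin.isCoxeterNumber_E_eight))) h30
end
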